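/- arXiv:1309.3780 — 6 statements merged into one kernel-verified Lean document; each statement's English description precedes it below -/
import Mathlib

section
/- Let d ≥ 1, let f : ℝ^d → ℝ^d be a C^1 map, let z be a periodic point of f of period k ≥ 1 whose orbit γ = {z, f(z), …, f^{k−1}(z)} is expanding, i.e. there is λ > 1 with ‖D(f^k)_z(v)‖ ≥ λ‖v‖ for all v ∈ ℝ^d, and suppose there is a regular homoclinic orbit associated to γ. Then for every open set U containing γ there exist an integer m ≥ 1 and a nonempty compact set K ⊆ U such that: f^m(K) = K; the restriction of f^m to K is expanding, i.e. there are C > 0 and λ' > 1 with ‖D(f^{mn})_x(v)‖ ≥ C·λ'^n·‖v‖ for every x ∈ K, v ∈ ℝ^d and n ≥ 1; and there is a homeomorphism h from K onto the space {0,1}^ℕ (with the product topology) satisfying h(f^m(x)) = σ(h(x)) for all x ∈ K, where σ is the one-sided shift σ(s)(n) = s(n+1). In particular K is a Cantor set. -/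
open Filter Metric Set

/-- The limit set of an iterated function system of two contractions with disjoint images is
parametrised by binary sequences. -/
theorem exists_coding_map {S : Type*} [MetricSpace S] [CompleteSpace S] [BoundedSpace S]
    [Nonempty S] {c : NNReal} (hc : c < 1) (A : Bool → S → S)
    (hA : ∀ b, LipschitzWith c (A b)) (hinj : ∀ b, Function.Injective (A b))
    (hdisj : ∀ u v, A true u ≠ A false v) :
    ∃ π : (ℕ → Bool) → S, Continuous π ∧ Function.Injective π ∧
      ∀ s, π s = A (s 0) (π fun n => s (n + 1)) := by
  let σ : C(ℕ → Bool, ℕ → Bool) := ⟨fun s n => s (n + 1), by fun_prop⟩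
  have hcont : Continuous fun p : Bool × S => A p.1 p.2 :=
    continuous_prod_of_discrete_left.2 fun b => (hA b).continuous
  let T : C(ℕ → Bool, S) → C(ℕ → Bool, S) := fun π =>
    ⟨fun s => A (s 0) (π (σ s)), hcont.comp (by fun_prop : Continuous fun s => (s 0, π (σ s)))⟩
  have hT : ContractingWith c T := by
    refine ⟨hc, LipschitzWith.of_dist_le_mul fun π ρ => ?_⟩
    rw [ContinuousMap.dist_le (by positivity)]
    intro s
    exact ((hA (s 0)).dist_le_mul _ _).trans
      (mul_le_mul_of_nonneg_left (ContinuousMap.dist_apply_le_dist _) c.2)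
  have : Nonempty C(ℕ → Bool, S) := ⟨ContinuousMap.const _ (Classical.arbitrary S)⟩
  let π := hT.fixedPoint T
  have hπ : ∀ s, π s = A (s 0) (π fun n => s (n + 1)) := fun s =>
    (DFunLike.congr_fun hT.fixedPoint_isFixedPt s).symm
  have hA' : ∀ b b' u v, A b u = A b' v → b = b' := by
    rintro (_ | _) (_ | _) u v huv
    · rfl
    · exact absurd huv.symm (hdisj _ _)
    · exact absurd huv (hdisj _ _)
    · rfl
  refine ⟨π, π.continuous, fun s t hst => funext fun n => ?_, hπ⟩
  induction n generalizing s t with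
  | zero =>
    rw [hπ s, hπ t] at hst
    exact hA' _ _ _ _ hst
  | succ n ih =>
    have h0 : s 0 = t 0 := by
      rw [hπ s, hπ t] at hst
      exact hA' _ _ _ _ hst
    rw [hπ s, hπ t, h0] at hst
    exact ih _ _ (hinj _ hst)

/-- Two contractions of a set with disjoint images which are right inverses of `F` produce a
compact set on which `F` is conjugate to the full shift on two symbols. -/
theorem exists_conj_shift {X : Type*} [MetricSpace X] {S : Set X} (hS : IsComplete S)
    (hbd : Bornology.IsBounded S) (hne : S.Nonempty) {c : NNReal} (hc : c < 1)
    (F : X → X) (A : Bool → X → X) (hmaps : ∀ b, MapsTo (A b) S S)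
    (hA : ∀ b, LipschitzOnWith c (A b) S) (hFA : ∀ b, ∀ w ∈ S, F (A b w) = w)
    (hdisj : ∀ u ∈ S, ∀ v ∈ S, A true u ≠ A false v) :
    ∃ K : Set X, K.Nonempty ∧ IsCompact K ∧ K ⊆ S ∧ F '' K = K ∧
      (∀ y ∈ K, ∃ b, ∃ w ∈ K, y = A b w) ∧
      ∃ h : K ≃ₜ (ℕ → Bool), ∀ (y : K) (hy : F (y : X) ∈ K),
        h ⟨F (y : X), hy⟩ = fun n => h y (n + 1) := by
  have : CompleteSpace S := hS.completeSpace_coe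
  have : Nonempty S := hne.to_subtype
  have : BoundedSpace S := boundedSpace_val_set_iff.2 hbd
  obtain ⟨π, hcont, hinj, hπ⟩ := exists_coding_map hc (fun b => (hmaps b).restrict (A b) S S)
    (fun b => (hA b).mapsToRestrict (hmaps b))
    (fun b u v huv => Subtype.ext <| by
      have := congrArg (fun p : S => F p) huv
      simpa [hFA b _ u.2, hFA b _ v.2] using this)
    (fun u v huv => hdisj u u.2 v v.2 (congrArg Subtype.val huv))
  let p : (ℕ → Bool) → X := fun s => π s
  have hpc : Continuous p := continuous_subtype_val.comp hcont
  have hpi : Function.Injective p := Subtype.val_injective.comp hinj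
  have hp : ∀ s, p s = A (s 0) (p fun n => s (n + 1)) := fun s => congrArg Subtype.val (hπ s)
  have hF : ∀ s, F (p s) = p fun n => s (n + 1) := fun s => by
    rw [hp s, hFA _ _ (π _).2]
  have hemb := (hpc.isClosedEmbedding hpi).isEmbedding
  refine ⟨range p, range_nonempty p, isCompact_range hpc, ?_, ?_, ?_, hemb.toHomeomorph.symm, ?_⟩
  · rintro _ ⟨s, rfl⟩
    exact (π s).2
  · ext y
    constructor
    · rintro ⟨_, ⟨s, rfl⟩, rfl⟩
      exact ⟨_, (hF s).symm⟩
    · rintro ⟨s, rfl⟩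
      refine ⟨_, ⟨fun n => Nat.casesOn n true s, rfl⟩, ?_⟩
      rw [hF]
  · rintro _ ⟨s, rfl⟩
    exact ⟨s 0, _, ⟨_, rfl⟩, hp s⟩
  · rintro ⟨_, s, rfl⟩ hy
    have h1 : hemb.toHomeomorph.symm ⟨p s, s, rfl⟩ = s :=
      hemb.toHomeomorph.symm_apply_apply s
    rw [h1, Homeomorph.symm_apply_eq]
    exact Subtype.ext (hF s)

section
variable {E : Type*} [NormedAddCommGroup E] [NormedSpace ℝ E]

theorem ContDiff.iterate_self {n : WithTop ℕ∞} {f : E → E} (hf : ContDiff ℝ n f) (i : ℕ) :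
    ContDiff ℝ n f^[i] := by
  induction i with
  | zero => exact contDiff_id
  | succ i ih => exact ih.comp hf

theorem exists_local_right_inverse [CompleteSpace E] {F : E → E} (hF : ContDiff ℝ 1 F) {p z : E}
    (hp : F p = z) (hbij : Function.Bijective (fderiv ℝ F p)) :
    ∃ ψ : E → E, ψ z = p ∧ ContDiffAt ℝ 1 ψ z ∧ (∀ᶠ w in nhds z, F (ψ w) = w) ∧
      ∀ᶠ w in nhds z, DifferentiableAt ℝ ψ w := by
  subst hp
  let e := ContinuousLinearEquiv.ofBijective (fderiv ℝ F p)
    (LinearMap.ker_eq_bot.2 hbij.1) (LinearMap.range_eq_top.2 hbij.2)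
  have he : HasFDerivAt F (e : E →L[ℝ] E) p := ((hF.differentiable one_ne_zero) p).hasFDerivAt
  have hc := hF.contDiffAt (x := p)
  have hψ := hc.to_localInverse he one_ne_zero
  refine ⟨hc.localInverse he one_ne_zero, hc.localInverse_apply_image he one_ne_zero, hψ,
    (hc.hasStrictFDerivAt' he one_ne_zero).eventually_right_inverse, ?_⟩
  exact (hψ.eventually (by simp)).mono fun w hw => hw.differentiableAt one_ne_zero

theorem norm_le_norm_fderiv_of_right_inverse [FiniteDimensional ℝ E] {F A : E → E} {w : E}
    {c : NNReal} (hF : DifferentiableAt ℝ F (A w)) (hA : DifferentiableAt ℝ A w)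
    {s : Set E} (hs : s ∈ nhds w) (hL : LipschitzOnWith c A s) (hFA : ∀ u ∈ s, F (A u) = u)
    (v : E) : ‖v‖ ≤ c * ‖fderiv ℝ F (A w) v‖ := by
  have hcomp : (fderiv ℝ F (A w)).comp (fderiv ℝ A w) = ContinuousLinearMap.id ℝ E := by
    have h1 := hF.hasFDerivAt.comp w hA.hasFDerivAt
    refine h1.unique ((hasFDerivAt_id w).congr_of_eventuallyEq ?_)
    filter_upwards [hs] with u hu using hFA u hu
  have hinv : (fderiv ℝ A w).toLinearMap ∘ₗ (fderiv ℝ F (A w)).toLinearMap = LinearMap.id :=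
    (LinearMap.comp_eq_id_comm ..).1 (by
      ext v; simpa using DFunLike.congr_fun hcomp v)
  have hn : ‖fderiv ℝ A w‖ ≤ c := norm_fderiv_le_of_lipschitzOn ℝ hs hL
  calc ‖v‖ = ‖fderiv ℝ A w (fderiv ℝ F (A w) v)‖ := by
        congr 1; exact (DFunLike.congr_fun hinv v).symm
    _ ≤ c * _ := ContinuousLinearMap.le_of_opNorm_le _ hn _

theorem le_norm_fderiv_iterate {F : E → E} (hF : Differentiable ℝ F) {K : Set E}
    (hK : MapsTo F K K) {a : ℝ} (ha : 0 ≤ a)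
    (hexp : ∀ y ∈ K, ∀ v, a * ‖v‖ ≤ ‖fderiv ℝ F y v‖) (n : ℕ) :
    ∀ y ∈ K, ∀ v, a ^ n * ‖v‖ ≤ ‖fderiv ℝ F^[n] y v‖ := by
  induction n with
  | zero => intro y _ v; simp
  | succ n ih =>
    intro y hy v
    rw [Function.iterate_succ, fderiv_comp _ (hF.iterate n _) (hF y)]
    calc a ^ (n + 1) * ‖v‖ = a ^ n * (a * ‖v‖) := by ring
      _ ≤ a ^ n * ‖fderiv ℝ F y v‖ := by gcongr; exact hexp y hy v
      _ ≤ _ := ih _ (hK hy) _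

/-- The local inverse of a `C¹` map at an expanding fixed point. -/
theorem exists_contracting_right_inverse [FiniteDimensional ℝ E] {g : E → E}
    (hg : ContDiff ℝ 1 g) {z : E} (hz : g z = z) {lam : ℝ} (hlam : 1 < lam)
    (hexp : ∀ v, lam * ‖v‖ ≤ ‖fderiv ℝ g z v‖) :
    ∃ (φ : E → E) (μ : NNReal) (ρ : ℝ), μ < 1 ∧ 0 < ρ ∧ φ z = z ∧
      LipschitzOnWith μ φ (ball z ρ) ∧ (∀ w ∈ ball z ρ, g (φ w) = w) ∧
      ∀ w ∈ ball z ρ, DifferentiableAt ℝ φ w := by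
  have hinj : Function.Injective (fderiv ℝ g z) := by
    refine (injective_iff_map_eq_zero _).2 fun v hv => ?_
    have := hexp v
    rw [hv, norm_zero] at this
    exact norm_eq_zero.1 (le_antisymm (by nlinarith [norm_nonneg v]) (norm_nonneg v))
  have := FiniteDimensional.complete ℝ E
  obtain ⟨φ, hφz, hφC, hφr, hφd⟩ := exists_local_right_inverse hg hz
    ⟨hinj, LinearMap.injective_iff_surjective.1 hinj⟩
  have hφ := hφC.differentiableAt one_ne_zero
  have hcomp : (fderiv ℝ g z).comp (fderiv ℝ φ z) = ContinuousLinearMap.id ℝ E := by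
    have h1 : HasFDerivAt g (fderiv ℝ g z) (φ z) := by
      rw [hφz]; exact (hg.differentiable one_ne_zero z).hasFDerivAt
    exact (h1.comp z hφ.hasFDerivAt).unique ((hasFDerivAt_id z).congr_of_eventuallyEq hφr)
  have hnorm : ‖fderiv ℝ φ z‖ ≤ lam⁻¹ := by
    refine ContinuousLinearMap.opNorm_le_bound _ (by positivity) fun v => ?_
    have h1 := hexp (fderiv ℝ φ z v)
    have h2 : fderiv ℝ g z (fderiv ℝ φ z v) = v := DFunLike.congr_fun hcomp v
    rw [h2] at h1
    rwa [← div_eq_inv_mul, le_div_iff₀' (by linarith)]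
  have hlt : ‖fderiv ℝ φ z‖ < 1 := hnorm.trans_lt (inv_lt_one_of_one_lt₀ hlam)
  obtain ⟨μ, hμ1, hμ2⟩ := exists_between (show ‖fderiv ℝ φ z‖₊ < 1 from hlt)
  obtain ⟨t, ht, hL⟩ := hφC.exists_lipschitzOnWith_of_nnnorm_lt μ hμ1
  obtain ⟨ρ, hρ, hball⟩ := Metric.mem_nhds_iff.1 (inter_mem ht (inter_mem hφr hφd))
  exact ⟨φ, μ, ρ, hμ2, hρ, hφz, hL.mono fun w hw => (hball hw).1, fun w hw => (hball hw).2.1,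
    fun w hw => (hball hw).2.2⟩

theorem LipschitzOnWith.mapsTo_ball_of_isFixedPt {X : Type*} [PseudoMetricSpace X] {φ : X → X} {μ : NNReal}
    (hμ : μ < 1) {z : X} {ρ : ℝ} (hρ : 0 < ρ) (hz : φ z = z) (hL : LipschitzOnWith μ φ (ball z ρ)) :
    MapsTo φ (ball z ρ) (ball z ρ) := by
  intro w hw
  have h1 := hL.dist_le_mul w hw z (mem_ball_self hρ)
  rw [hz] at h1
  have h2 : (μ : ℝ) < 1 := hμ
  rw [mem_ball] at hw ⊢
  nlinarith [dist_nonneg (x := w) (y := z)]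

/-- Iterates of a contracting local inverse. -/
theorem contracting_right_inverse_iterate {g φ : E → E} {μ : NNReal} (hμ : μ < 1) {z : E} {ρ : ℝ}
    (hρ : 0 < ρ) (hz : φ z = z) (hL : LipschitzOnWith μ φ (ball z ρ))
    (hr : ∀ w ∈ ball z ρ, g (φ w) = w) (hd : ∀ w ∈ ball z ρ, DifferentiableAt ℝ φ w) (n : ℕ) :
    MapsTo φ^[n] (ball z ρ) (ball z ρ) ∧ LipschitzOnWith (μ ^ n) φ^[n] (ball z ρ) ∧
      (∀ w ∈ ball z ρ, g^[n] (φ^[n] w) = w) ∧ ∀ w ∈ ball z ρ, DifferentiableAt ℝ φ^[n] w := by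
  have hmaps := hL.mapsTo_ball_of_isFixedPt hμ hρ hz
  refine ⟨hmaps.iterate n, ?_, ?_, ?_⟩
  · induction n with
    | zero => simpa using LipschitzWith.id.lipschitzOnWith
    | succ n ih =>
      rw [Function.iterate_succ, pow_succ]
      exact ih.comp hL hmaps
  · induction n with
    | zero => simp
    | succ n ih =>
      intro w hw
      rw [Function.iterate_succ_apply g, Function.iterate_succ_apply' φ, hr _ (hmaps.iterate n hw)]
      exact ih w hw
  · induction n with
    | zero => intro w _; exact differentiableAt_id
    | succ n ih =>
      intro w hw
      rw [Function.iterate_succ]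
      exact (ih _ (hmaps hw)).comp w (hd w hw)
end

/-- An orbit approaching a finite invariant set eventually shadows the dynamics on that set. -/
theorem exists_shadowing_of_tendsto_infDist {X : Type*} [MetricSpace X] {f : X → X}
    (hf : Continuous f) {γ : Set X} (hfin : γ.Finite) (hne : γ.Nonempty) (hinv : MapsTo f γ γ)
    {x : ℤ → X} (horb : ∀ n, f (x (n + 1)) = x n) {l : Filter ℤ}
    (hl : Tendsto (fun n : ℤ => n + 1) l l) (hx : Tendsto (fun n => infDist (x n) γ) l (nhds 0)) :
    ∃ p : ℤ → X, (∀ n, p n ∈ γ) ∧ Tendsto (fun n => dist (x n) (p n)) l (nhds 0) ∧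
      ∀ᶠ n in l, f (p (n + 1)) = p n := by
  choose p hp hpd using fun n => hfin.isCompact.exists_infDist_eq_dist hne (x n)
  have hd : Tendsto (fun n => dist (x n) (p n)) l (nhds 0) := by simpa only [hpd] using hx
  obtain ⟨η, hη, hsep⟩ : ∃ η > 0, ∀ a ∈ γ, ∀ b ∈ γ, dist a b < η → a = b := by
    obtain ⟨C, hC, h⟩ := Set.einfsep_pos.1 hfin.einfsep_pos
    obtain ⟨η, hη0, hη⟩ := ENNReal.lt_iff_exists_nnreal_btwn.1 hC
    refine ⟨η, by exact_mod_cast hη0, fun a ha b hb hab => ?_⟩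
    by_contra hne
    have h1 := hη.trans_le (h a ha b hb hne)
    rw [edist_nndist] at h1
    have h2 : η < nndist a b := by exact_mod_cast h1
    exact absurd hab (not_lt.2 (by exact_mod_cast h2.le))
  refine ⟨p, hp, hd, ?_⟩
  obtain ⟨δ, hδ, hcont⟩ := Metric.mem_uniformity_dist.1
    (hfin.isCompact.uniformContinuousAt_of_continuousAt f (fun a _ => hf.continuousAt)
      (Metric.dist_mem_uniformity (half_pos hη)))
  filter_upwards [(hd.comp hl).eventually (gt_mem_nhds hδ), hd.eventually (gt_mem_nhds (half_pos hη))]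
    with n h1 h2
  refine hsep _ (hinv (hp _)) _ (hp _) ?_
  have h3 : dist (f (p (n + 1))) (f (x (n + 1))) < η / 2 :=
    hcont (by rw [dist_comm]; exact h1) (hp _)
  rw [horb] at h3
  linarith [dist_triangle (f (p (n + 1))) (x n) (p n)]

theorem exists_tendsto_periodic_point {X : Type*} [MetricSpace X] {f : X → X}
    (hf : Continuous f) {z : X} {k : ℕ} (hk : 1 ≤ k) (hper : f^[k] z = z)
    {γ : Set X} (hγ : γ = {y | ∃ i < k, y = f^[i] z})
    {x : ℤ → X} (horb : ∀ n, f (x (n + 1)) = x n)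
    (hfor : Tendsto (fun n => infDist (x n) γ) atTop (nhds 0))
    (hback : Tendsto (fun n => infDist (x n) γ) atBot (nhds 0)) :
    (∃ a : ℤ, Tendsto (fun j : ℕ => x (a + k * j)) atTop (nhds z)) ∧
      ∃ a : ℤ, Tendsto (fun j : ℕ => x (a - k * j)) atTop (nhds z) := by
  have hzγ : z ∈ γ := hγ ▸ ⟨0, hk, rfl⟩
  have hfin : γ.Finite := by
    refine ((Set.finite_lt_nat k).image fun i => f^[i] z).subset ?_
    rw [hγ]
    rintro _ ⟨i, hi, rfl⟩
    exact ⟨i, hi, rfl⟩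
  have hinv : MapsTo f γ γ := by
    rw [hγ]
    rintro _ ⟨i, hi, rfl⟩
    rcases Nat.lt_or_ge (i + 1) k with h | h
    · exact ⟨i + 1, h, (Function.iterate_succ_apply' f i z).symm⟩
    · obtain rfl : k = i + 1 := by omega
      exact ⟨0, by omega, by rw [← Function.iterate_succ_apply' f i z, hper]; rfl⟩
  have hγk : ∀ q ∈ γ, f^[k] q = q := by
    rw [hγ]
    rintro _ ⟨i, hi, rfl⟩
    rw [← Function.iterate_add_apply, Nat.add_comm, Function.iterate_add_apply, hper]
  have hγkj : ∀ q ∈ γ, ∀ j, f^[k * j] q = q := fun q hq j => by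
    rw [Function.iterate_mul]; exact Function.iterate_fixed (hγk q hq) j
  have hkpos : (0 : ℤ) < k := by exact_mod_cast hk
  constructor
  · obtain ⟨p, hp, hd, hev⟩ := exists_shadowing_of_tendsto_infDist hf hfin ⟨z, hzγ⟩ hinv horb
      (tendsto_atTop_add_const_right _ 1 tendsto_id) hfor
    obtain ⟨N, hN⟩ := eventually_atTop.1 hev
    have hit : ∀ i : ℕ, ∀ n ≥ N, f^[i] (p (n + i)) = p n := by
      intro i
      induction i with
      | zero => simp
      | succ i ih =>
        intro n hn
        rw [Function.iterate_succ_apply, Nat.cast_succ, ← add_assoc, hN _ (by omega), ih n hn]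
    obtain ⟨i, hi, hpi⟩ : ∃ i < k, p (N + k) = f^[i] z := by
      have := hp (N + k)
      rwa [hγ] at this
    have h1 : p (N + i) = z := by
      have := hit (k - i) (N + i) (by omega)
      rw [show N + i + ((k - i : ℕ) : ℤ) = N + k by omega, hpi, ← Function.iterate_add_apply,
        Nat.sub_add_cancel hi.le, hper] at this
      exact this.symm
    refine ⟨N + i, tendsto_iff_dist_tendsto_zero.2 ?_⟩
    have h2 : ∀ j : ℕ, p (N + i + k * j) = z := fun j => by
      have := hit (k * j) (N + i) (by omega)
      rw [hγkj _ (hp _), h1] at this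
      exact_mod_cast this
    have h3 : Tendsto (fun j : ℕ => N + i + (k : ℤ) * j) atTop atTop :=
      tendsto_atTop_add_const_left _ _
        (tendsto_natCast_atTop_atTop.const_mul_atTop' hkpos)
    simpa only [Function.comp_def, h2] using hd.comp h3
  · obtain ⟨p, hp, hd, hev⟩ := exists_shadowing_of_tendsto_infDist hf hfin ⟨z, hzγ⟩ hinv horb
      (tendsto_atBot_add_const_right _ 1 tendsto_id) hback
    obtain ⟨N, hN⟩ := eventually_atBot.1 hev
    have hit : ∀ i : ℕ, ∀ n ≤ N, p (n - i) = f^[i] (p n) := by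
      intro i
      induction i with
      | zero => simp
      | succ i ih =>
        intro n hn
        rw [Function.iterate_succ_apply', ← ih n hn, Nat.cast_succ, ← hN _ (by omega)]
        congr 2
        ring
    obtain ⟨i, hi, hpi⟩ : ∃ i < k, p N = f^[i] z := by
      have := hp N
      rwa [hγ] at this
    have h1 : p (N - (k - i : ℕ)) = z := by
      rw [hit _ _ le_rfl, hpi, ← Function.iterate_add_apply, Nat.sub_add_cancel hi.le, hper]
    refine ⟨N - (k - i : ℕ), tendsto_iff_dist_tendsto_zero.2 ?_⟩
    have h2 : ∀ j : ℕ, p (N - (k - i : ℕ) - k * j) = z := fun j => by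
      have := hit (k * j) (N - (k - i : ℕ)) (by omega)
      rw [hγkj _ (hp _), h1] at this
      exact_mod_cast this
    have h3 : Tendsto (fun j : ℕ => N - (k - i : ℕ) - (k : ℤ) * j) atTop atBot := by
      simp only [sub_eq_add_neg _ ((k : ℤ) * _)]
      exact tendsto_atBot_add_const_left _ _ (tendsto_neg_atTop_atBot.comp
        (tendsto_natCast_atTop_atTop.const_mul_atTop' hkpos))
    simpa only [Function.comp_def, h2] using hd.comp h3

theorem eventually_eq_of_tendsto_expanding_fixed {E : Type*} [NormedAddCommGroup E]
    [NormedSpace ℝ E] {g : E → E} {z : E} (hg : DifferentiableAt ℝ g z) (hz : g z = z) {lam : ℝ}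
    (hlam : 1 < lam) (hexp : ∀ v, lam * ‖v‖ ≤ ‖fderiv ℝ g z v‖) {u : ℕ → E}
    (hu : ∀ j, g (u j) = u (j + 1)) (hlim : Tendsto u atTop (nhds z)) :
    ∃ j, u j = z := by
  have hloc : ∀ᶠ a in nhds z, ‖a - z‖ ≤ ‖g a - z‖ := by
    filter_upwards [hg.hasFDerivAt.isLittleO.def (sub_pos.2 hlam)] with a ha
    rw [hz] at ha
    have h1 := hexp (a - z)
    have h2 := norm_sub_norm_le (fderiv ℝ g z (a - z)) (g a - z)
    rw [norm_sub_rev (fderiv ℝ g z (a - z))] at h2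
    linarith
  obtain ⟨J, hJ⟩ := eventually_atTop.1 (hlim.eventually hloc)
  have hmono : Monotone fun j => ‖u (J + j) - z‖ := monotone_nat_of_le_succ fun j => by
    have := hJ (J + j) (by omega)
    rwa [hu] at this
  have hl0 : Tendsto (fun j => ‖u (J + j) - z‖) atTop (nhds 0) := by
    have h1 := tendsto_iff_norm_sub_tendsto_zero.1 hlim
    simpa only [Function.comp_def, add_comm] using h1.comp (tendsto_add_atTop_nat J)
  have := hmono.ge_of_tendsto hl0 0
  exact ⟨J, sub_eq_zero.1 (norm_eq_zero.1 (le_antisymm (by simpa using this) (norm_nonneg _)))⟩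

theorem bijective_fderiv_iterate_of_orbit {E : Type*} [NormedAddCommGroup E]
    [NormedSpace ℝ E] {f : E → E} (hf : Differentiable ℝ f) {x : ℤ → E}
    (horb : ∀ n, f (x (n + 1)) = x n) (hreg : ∀ n, Function.Bijective (fderiv ℝ f (x n)))
    (M : ℕ) (n : ℤ) : Function.Bijective (fderiv ℝ f^[M] (x n)) := by
  induction M generalizing n with
  | zero => simpa using Function.bijective_id
  | succ M ih =>
    have h1 : f (x n) = x (n - 1) := by rw [← horb (n - 1), sub_add_cancel]
    rw [Function.iterate_succ, fderiv_comp _ (hf.iterate M _) (hf _), h1]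
    exact (ih _).comp (hreg n)

/-- A contracting local inverse of `g` at a fixed point `z`, together with a local inverse of an
iterate of the map at `z` whose value at `z` is a homoclinic point near `z`, generate a pair of
contractions which are right inverses of `f^[m]` and have disjoint images. -/
theorem exists_disjoint_contractions {E : Type*} [NormedAddCommGroup E] [NormedSpace ℝ E]
    {f : E → E} {z q : E} {k M : ℕ} {φ ψ : E → E} {μ : NNReal} {ρ : ℝ}
    (hμ : μ < 1) (hρ : 0 < ρ) (hφz : φ z = z) (hφL : LipschitzOnWith μ φ (ball z ρ))
    (hφr : ∀ w ∈ ball z ρ, f^[k] (φ w) = w) (hφd : ∀ w ∈ ball z ρ, DifferentiableAt ℝ φ w)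
    (hq : q ∈ ball z ρ) (hqz : q ≠ z) (hψz : ψ z = q) (hψC : ContDiffAt ℝ 1 ψ z)
    (hψr : ∀ᶠ w in nhds z, f^[M] (ψ w) = w) (hψd : ∀ᶠ w in nhds z, DifferentiableAt ℝ ψ w)
    {U : Set E} (hU : U ∈ nhds z) (hk : 1 ≤ k) :
    ∃ (m : ℕ) (R : ℝ) (A : Bool → E → E), 1 ≤ m ∧ 0 < R ∧ ball z R ⊆ U ∧
      (∀ b, MapsTo (A b) (closedBall z (R / 2)) (closedBall z (R / 2))) ∧
      (∀ b, LipschitzOnWith (1 / 2) (A b) (ball z R)) ∧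
      (∀ b, ∀ w ∈ ball z R, f^[m] (A b w) = w) ∧
      (∀ b, ∀ w ∈ ball z R, DifferentiableAt ℝ (A b) w) ∧
      ∀ u ∈ ball z R, ∀ v ∈ ball z R, A true u ≠ A false v := by
  have hzρ : z ∈ ball z ρ := mem_ball_self hρ
  have hμ' : (μ : ℝ) < 1 := hμ
  have hφq : q ≠ φ q := fun h => by
    have h1 := hφL.dist_le_mul q hq z hzρ
    rw [hφz, ← h] at h1
    nlinarith [dist_pos.2 hqz]
  have hφmaps := hφL.mapsTo_ball_of_isFixedPt hμ hρ hφz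
  have hφc : ∀ w ∈ ball z ρ, ContinuousAt φ w := fun w hw => (hφd w hw).continuousAt
  have hφlim : Tendsto φ (nhds z) (nhds z) := by simpa [ContinuousAt, hφz] using hφc z hzρ
  have hψlim : Tendsto ψ (nhds z) (nhds q) := by
    simpa [ContinuousAt, hψz] using hψC.continuousAt
  obtain ⟨O₁, O₂, hO₁, hO₂, hqO₁, hqO₂, hO⟩ := t2_separation hφq
  obtain ⟨L, t, ht, hL⟩ := hψC.exists_lipschitzOnWith
  have hev : ∀ᶠ w in nhds z, w ∈ U ∧ w ∈ ball z ρ ∧ w ∈ t ∧ f^[M] (ψ w) = w ∧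
      DifferentiableAt ℝ ψ w ∧ ψ w ∈ ball z ρ ∧ ψ (φ w) ∈ O₁ ∧ φ (ψ w) ∈ O₂ := by
    filter_upwards [hU, ball_mem_nhds z hρ, ht, hψr, hψd,
      hψlim.eventually (isOpen_ball.mem_nhds hq),
      (hψlim.comp hφlim).eventually (hO₁.mem_nhds hqO₁),
      ((hφc q hq).tendsto.comp hψlim).eventually (hO₂.mem_nhds hqO₂)]
      with w h1 h2 h3 h4 h5 h6 h7 h8 using ⟨h1, h2, h3, h4, h5, h6, h7, h8⟩
  obtain ⟨R, hR, hball⟩ := Metric.mem_nhds_iff.1 hev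
  have hRρ : ball z R ⊆ ball z ρ := fun w hw => (hball hw).2.1
  have hφR : MapsTo φ (ball z R) (ball z R) :=
    (hφL.mono hRρ).mapsTo_ball_of_isFixedPt hμ hR hφz
  have hψR : MapsTo ψ (ball z R) (ball z ρ) := fun w hw => (hball hw).2.2.2.2.2.1
  have hψLR : LipschitzOnWith L ψ (ball z R) := hL.mono fun w hw => (hball hw).2.2.1
  let B : Bool → E → E := fun b => if b then ψ ∘ φ else φ ∘ ψ
  have hBmaps : ∀ b, MapsTo (B b) (ball z R) (ball z ρ) := by
    rintro (_ | _)
    · exact hφmaps.comp hψR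
    · exact hψR.comp hφR
  have hBL : ∀ b, LipschitzOnWith L (B b) (ball z R) := by
    rintro (_ | _)
    · exact (hφL.comp hψLR hψR).weaken (mul_le_of_le_one_left' hμ.le)
    · exact (hψLR.comp (hφL.mono hRρ) hφR).weaken (mul_le_of_le_one_right' hμ.le)
  have hBd : ∀ b, ∀ w ∈ ball z R, DifferentiableAt ℝ (B b) w := by
    rintro (_ | _) w hw
    · exact (hφd _ (hψR hw)).comp w (hball hw).2.2.2.2.1
    · exact (hball (hφR hw)).2.2.2.2.1.comp w (hφd _ (hRρ hw))
  have hBr : ∀ b, ∀ w ∈ ball z R, f^[M + k] (B b w) = w := by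
    rintro (_ | _) w hw
    · rw [Function.iterate_add_apply]
      change f^[M] (f^[k] (φ (ψ w))) = w
      rw [hφr _ (hψR hw), (hball hw).2.2.2.1]
    · rw [add_comm, Function.iterate_add_apply]
      change f^[k] (f^[M] (ψ (φ w))) = w
      rw [(hball (hφR hw)).2.2.2.1, hφr _ (hRρ hw)]
  have hBdisj : ∀ u ∈ ball z R, ∀ v ∈ ball z R, B true u ≠ B false v := fun u hu v hv =>
    hO.ne_of_mem (hball hu).2.2.2.2.2.2.1 (hball hv).2.2.2.2.2.2.2
  have hpow := tendsto_pow_atTop_nhds_zero_of_lt_one μ.coe_nonneg hμ'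
  obtain ⟨j, hj₁, hj₂⟩ : ∃ j : ℕ, (μ : ℝ) ^ j * L ≤ 1 / 2 ∧ (μ : ℝ) ^ j * ρ ≤ R / 2 := by
    have h1 := hpow.mul_const (L : ℝ)
    have h2 := hpow.mul_const ρ
    rw [zero_mul] at h1 h2
    exact ((h1.eventually (ge_mem_nhds (by norm_num))).and
      (h2.eventually (ge_mem_nhds (half_pos hR)))).exists
  obtain ⟨hjmaps, hjL, hjr, hjd⟩ :=
    contracting_right_inverse_iterate hμ hρ hφz hφL hφr hφd j
  have hRR : closedBall z (R / 2) ⊆ ball z R := closedBall_subset_ball (half_lt_self hR)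
  refine ⟨M + k + k * j, R, fun b => φ^[j] ∘ B b, by omega, hR, fun w hw => (hball hw).1,
    fun b w hw => ?_, fun b => ?_, fun b w hw => ?_, fun b w hw => ?_, fun u hu v hv huv => ?_⟩
  · have h1 := hBmaps b (hRR hw)
    have h2 := hjL.dist_le_mul _ h1 z hzρ
    rw [Function.iterate_fixed hφz, NNReal.coe_pow] at h2
    refine h2.trans (le_trans ?_ hj₂)
    gcongr
    exact (mem_ball.1 h1).le
  · exact (hjL.comp (hBL b) (hBmaps b)).weaken (by exact_mod_cast hj₁)
  · change f^[M + k + k * j] (φ^[j] (B b w)) = w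
    rw [Function.iterate_add_apply, Function.iterate_mul, hjr _ (hBmaps b hw), hBr b w hw]
  · exact (hjd _ (hBmaps b hw)).comp w (hBd b w hw)
  · have := congrArg (f^[k])^[j] (show φ^[j] (B true u) = φ^[j] (B false v) from huv)
    rw [hjr _ (hBmaps _ hu), hjr _ (hBmaps _ hv)] at this
    exact hBdisj u hu v hv this

/-- A regular homoclinic orbit associated to an expanding periodic
orbit of a `C¹` map of `ℝ^d` gives rise, inside any open set `U` containing the
orbit, to an invariant Cantor set on which a power of the map is expanding and
conjugated to the one-sided full shift on two symbols. -/
theorem regular_homoclinic_gives_expanding_cantor_set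
    (d : ℕ) (hd : 1 ≤ d)
    (f : EuclideanSpace ℝ (Fin d) → EuclideanSpace ℝ (Fin d))
    (hf : ContDiff ℝ 1 f)
    (z : EuclideanSpace ℝ (Fin d)) (k : ℕ) (hk : 1 ≤ k)
    (hper : f^[k] z = z)
    (γ : Set (EuclideanSpace ℝ (Fin d)))
    (hγ : γ = {y | ∃ i < k, y = f^[i] z})
    (hexp : ∃ lam > (1 : ℝ), ∀ v : EuclideanSpace ℝ (Fin d),
      lam * ‖v‖ ≤ ‖fderiv ℝ (f^[k]) z v‖)
    -- a regular homoclinic orbit associated to γ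
    (x : ℤ → EuclideanSpace ℝ (Fin d))
    (horb : ∀ n : ℤ, f (x (n + 1)) = x n)
    (hfor : Tendsto (fun n : ℤ => infDist (x n) γ) atTop (nhds 0))
    (hback : Tendsto (fun n : ℤ => infDist (x n) γ) atBot (nhds 0))
    (hescape : ∃ N : ℤ, x N ∉ γ)
    (hreg : ∀ n : ℤ, Function.Bijective (fderiv ℝ f (x n)))
    -- an arbitrary open set containing γ
    (U : Set (EuclideanSpace ℝ (Fin d))) (hUopen : IsOpen U) (hγU : γ ⊆ U) :
    ∃ (m : ℕ) (K : Set (EuclideanSpace ℝ (Fin d))), 1 ≤ m ∧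
      K.Nonempty ∧ IsCompact K ∧ K ⊆ U ∧ f^[m] '' K = K ∧
      (∃ C > (0 : ℝ), ∃ lam' > (1 : ℝ), ∀ y ∈ K, ∀ v : EuclideanSpace ℝ (Fin d),
        ∀ n : ℕ, 1 ≤ n → C * lam' ^ n * ‖v‖ ≤ ‖fderiv ℝ (f^[m * n]) y v‖) ∧
      ∃ h : K ≃ₜ (ℕ → Bool),
        ∀ (y : K) (hy : f^[m] (y : EuclideanSpace ℝ (Fin d)) ∈ K),
          h ⟨f^[m] (y : EuclideanSpace ℝ (Fin d)), hy⟩ = fun n => h y (n + 1) := by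
  obtain ⟨lam, hlam, hexp⟩ := hexp
  have hfk : ContDiff ℝ 1 f^[k] := hf.iterate_self k
  have hdiff : Differentiable ℝ f := hf.differentiable one_ne_zero
  have hfi : ∀ (i : ℕ) (n : ℤ), f^[i] (x (n + i)) = x n := by
    intro i
    induction i with
    | zero => simp
    | succ i ih =>
      intro n
      rw [Function.iterate_succ_apply, Nat.cast_succ, ← add_assoc, horb, ih]
  obtain ⟨⟨a, ha⟩, b, hb⟩ :=
    exists_tendsto_periodic_point hf.continuous hk hper hγ horb hfor hback
  have hzγ : z ∈ γ := hγ ▸ ⟨0, hk, rfl⟩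
  have hzit : ∀ i : ℕ, f^[i] z ∈ γ := fun i => by
    rw [hγ]
    exact ⟨i % k, Nat.mod_lt _ hk, ((show Function.IsPeriodicPt f k z from
      hper).iterate_mod_apply i).symm⟩
  obtain ⟨j₀, hj₀⟩ := eventually_eq_of_tendsto_expanding_fixed
    (hfk.differentiable one_ne_zero z) hper hlam hexp
    (fun j => by
      have := hfi k (b - k * (j + 1 : ℕ))
      rw [← this]
      congr 2
      push_cast
      ring) hb
  set c : ℤ := b - k * j₀ with hc
  obtain ⟨N, hN⟩ := hescape
  have hne : ∀ n ≥ N, x n ≠ z := fun n hn hz => by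
    obtain ⟨i, rfl⟩ := Int.le.dest hn
    exact hN (hfi i N ▸ hz ▸ hzit i)
  obtain ⟨φ, μ, ρ, hμ, hρ, hφz, hφL, hφr, hφd⟩ :=
    exists_contracting_right_inverse hfk hper hlam hexp
  have hkpos : (0 : ℤ) < k := by exact_mod_cast hk
  have hlarge : Tendsto (fun j : ℕ => a + (k : ℤ) * j) atTop atTop :=
    tendsto_atTop_add_const_left _ _ (tendsto_natCast_atTop_atTop.const_mul_atTop' hkpos)
  obtain ⟨j, ⟨hjρ, hjN⟩, hjc⟩ := (((ha.eventually (ball_mem_nhds z hρ)).and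
    (hlarge.eventually_ge_atTop N)).and (hlarge.eventually_ge_atTop c)).exists
  obtain ⟨M, hM⟩ := Int.le.dest hjc
  rw [← hM] at hjρ hjN
  obtain ⟨ψ, hψz, hψC, hψr, hψd⟩ := exists_local_right_inverse (hf.iterate_self M)
    ((hfi M c).trans hj₀) (bijective_fderiv_iterate_of_orbit hdiff horb hreg M (c + M))
  obtain ⟨m, R, A, hm, hR, hRU, hmaps, hAL, hAr, hAd, hdisj⟩ :=
    exists_disjoint_contractions hμ hρ hφz hφL hφr hφd hjρ (hne _ hjN) hψz hψC hψr hψd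
      (hUopen.mem_nhds (hγU hzγ)) hk
  have hRR : closedBall z (R / 2) ⊆ ball z R := closedBall_subset_ball (half_lt_self hR)
  obtain ⟨K, hKne, hKc, hKS, hKF, hKA, h, hh⟩ := exists_conj_shift
    isClosed_closedBall.isComplete isBounded_closedBall
    ⟨z, mem_closedBall_self (half_pos hR).le⟩ (by norm_num) f^[m] A hmaps
    (fun b => (hAL b).mono hRR) (fun b w hw => hAr b w (hRR hw))
    (fun u hu v hv => hdisj u (hRR hu) v (hRR hv))
  refine ⟨m, K, hm, hKne, hKc, hKS.trans (hRR.trans hRU), hKF, ⟨1, one_pos, 2, one_lt_two, ?_⟩,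
    h, hh⟩
  have hexpK : ∀ y ∈ K, ∀ v, 2 * ‖v‖ ≤ ‖fderiv ℝ f^[m] y v‖ := by
    intro y hy v
    obtain ⟨b, w, hw, rfl⟩ := hKA y hy
    have hwR := hRR (hKS hw)
    have := norm_le_norm_fderiv_of_right_inverse (hdiff.iterate m _) (hAd b w hwR)
      (isOpen_ball.mem_nhds hwR) (hAL b) (hAr b) v
    norm_num at this
    linarith
  intro y hy v n _
  rw [one_mul, Function.iterate_mul]
  exact le_norm_fderiv_iterate (hdiff.iterate m) (mapsTo_iff_image_subset.2 hKF.subset)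
    zero_le_two hexpK n y hy v
end

section
/- Let d ≥ 1, let f : ℝ^d → ℝ^d be a C^1 map and let K be an expanding set for f which is uncountable. Then there exist a periodic point z ∈ K of some period k ≥ 1 (whose orbit γ = {z, f(z), …, f^{k−1}(z)} is an expanding periodic orbit) and a homoclinic orbit associated to γ all of whose points lie in K. -/
open Filter Metric Set

/-- A `C¹` map whose derivative expands norms by a factor `4` along a compact set `K` is uniformly
locally expanding and uniformly locally surjective near the points of `K`. -/
lemma exists_radius_expanding_surjOn {E : Type*} [NormedAddCommGroup E] [NormedSpace ℝ E]
    [FiniteDimensional ℝ E] {F : E → E} (hF : ContDiff ℝ 1 F) {K : Set E} (hK : IsCompact K)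
    (hexp : ∀ x ∈ K, ∀ v, 4 * ‖v‖ ≤ ‖fderiv ℝ F x v‖) :
    ∃ R > 0, ∀ r > 0, r ≤ R → ∀ x ∈ K,
      (∀ u ∈ closedBall x r, ∀ v ∈ closedBall x r, 2 * dist u v ≤ dist (F u) (F v)) ∧
      SurjOn F (closedBall x r) (closedBall (F x) (2 * r)) := by
  have hcont : Continuous (fderiv ℝ F) := hF.continuous_fderiv one_ne_zero
  obtain ⟨R, hR, hRsub⟩ := Metric.mem_uniformity_dist.1
    (hK.uniformContinuousAt_of_continuousAt (fderiv ℝ F) (fun a _ => hcont.continuousAt)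
      (Metric.dist_mem_uniformity (zero_lt_two (α := ℝ))))
  refine ⟨R / 2, by positivity, fun r hr hrR x hx => ?_⟩
  have happ : ApproximatesLinearOn F (fderiv ℝ F x) (closedBall x r) 2 := by
    intro u hu v hv
    have := (convex_closedBall x r).norm_image_sub_le_of_norm_fderiv_le' (𝕜 := ℝ) (f := F)
      (φ := fderiv ℝ F x) (C := 2)
      (fun y _ => (hF.differentiable one_ne_zero).differentiableAt) (fun y hy => ?_) hv hu
    · simpa using this
    · have hd : dist x y < R := by
        rw [dist_comm]; exact (mem_closedBall.1 hy).trans_lt (by linarith)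
      have h2 : dist (fderiv ℝ F x) (fderiv ℝ F y) < 2 := hRsub hd hx
      rw [← dist_eq_norm, dist_comm]
      exact h2.le
  constructor
  · intro u hu v hv
    have h1 := happ u hu v hv
    have h2 := hexp x hx (u - v)
    have h3 := norm_sub_norm_le (fderiv ℝ F x (u - v)) (F u - F v)
    have h4 := norm_sub_rev (F u - F v) (fderiv ℝ F x (u - v))
    rw [dist_eq_norm, dist_eq_norm]
    simp only [NNReal.coe_ofNat] at h1
    linarith
  · have hinj : Function.Injective (fderiv ℝ F x : E →ₗ[ℝ] E) := by
      rw [← LinearMap.ker_eq_bot, LinearMap.ker_eq_bot']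
      intro v hv
      have h := hexp x hx v
      have hv' : fderiv ℝ F x v = 0 := hv
      rw [hv', norm_zero] at h
      exact norm_le_zero_iff.1 (by linarith)
    let e := LinearEquiv.ofInjectiveEndo (fderiv ℝ F x : E →ₗ[ℝ] E) hinj
    have he : ∀ y, fderiv ℝ F x (e.symm y) = y := e.apply_symm_apply
    let S : (fderiv ℝ F x).NonlinearRightInverse :=
      { toFun := e.symm
        nnnorm := 1 / 4
        bound' := fun y => by
          have h := hexp x hx (e.symm y)
          rw [he] at h
          norm_num
          linarith
        right_inv' := he }
    have hs := happ.surjOn_closedBall_of_nonlinearRightInverse S hr.le subset_rfl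
    have hc : (((S.nnnorm : ℝ)⁻¹ - (2 : NNReal)) * r) = 2 * r := by
      simp only [S]; norm_num
    rwa [hc] at hs

/-- Iterated contracting inverse branches of a map that is locally expanding and locally
surjective on `K`. -/
lemma exists_inverse_branch {X : Type*} [MetricSpace X] {F : X → X} {K : Set X} {r : ℝ}
    (hmaps : MapsTo F K K)
    (hexp : ∀ x ∈ K, ∀ u ∈ closedBall x r, ∀ v ∈ closedBall x r,
      2 * dist u v ≤ dist (F u) (F v))
    (hsurj : ∀ x ∈ K, SurjOn F (K ∩ closedBall x r) (K ∩ closedBall (F x) r)) (n : ℕ) :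
    ∀ x ∈ K, ∃ g : X → X, ∀ y ∈ K ∩ closedBall (F^[n] x) r,
      g y ∈ K ∧ F^[n] (g y) = y ∧ dist (g y) x ≤ (1 / 2) ^ n * dist y (F^[n] x) ∧
      ∀ y' ∈ K ∩ closedBall (F^[n] x) r, dist (g y) (g y') ≤ (1 / 2) ^ n * dist y y' := by
  induction n with
  | zero => exact fun x _ => ⟨id, fun y hy => ⟨hy.1, rfl, by simp, fun y' _ => by simp⟩⟩
  | succ n ih =>
    intro x hx
    obtain ⟨g, hg⟩ := ih (F x) (hmaps hx)
    have hpre : ∀ y, ∃ u, y ∈ K ∩ closedBall (F x) r → u ∈ K ∩ closedBall x r ∧ F u = y := by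
      intro y
      by_cases hy : y ∈ K ∩ closedBall (F x) r
      · obtain ⟨u, hu, hFu⟩ := hsurj x hx hy
        exact ⟨u, fun _ => ⟨hu, hFu⟩⟩
      · exact ⟨y, fun h => (hy h).elim⟩
    choose h hh using hpre
    have hgball : ∀ y ∈ K ∩ closedBall (F^[n] (F x)) r, g y ∈ K ∩ closedBall (F x) r := by
      intro y hy
      obtain ⟨h1, -, h3, -⟩ := hg y hy
      refine ⟨h1, mem_closedBall.2 (h3.trans ?_)⟩
      have hp : ((1 : ℝ) / 2) ^ n ≤ 1 := pow_le_one₀ (by norm_num) (by norm_num)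
      exact (mul_le_of_le_one_left dist_nonneg hp).trans hy.2
    refine ⟨h ∘ g, fun y hy => ?_⟩
    rw [Function.iterate_succ_apply] at hy
    rw [Function.iterate_succ_apply, Function.iterate_succ_apply]
    obtain ⟨h1, h2, h3, h4⟩ := hg y hy
    obtain ⟨hu, hFu⟩ := hh _ (hgball y hy)
    have hr : 0 ≤ r := dist_nonneg.trans hu.2
    refine ⟨hu.1, by simp [hFu, h2], ?_, fun y' hy' => ?_⟩
    · have := hexp x hx _ hu.2 x (mem_closedBall_self hr)
      rw [hFu] at this
      rw [pow_succ, Function.comp_apply]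
      linarith
    · obtain ⟨hu', hFu'⟩ := hh _ (hgball y' hy')
      have := hexp x hx _ hu.2 _ hu'.2
      rw [hFu, hFu'] at this
      have := h4 y' hy'
      rw [pow_succ, Function.comp_apply, Function.comp_apply]
      linarith

/-- Preimages in `K` of countable sets under iterates of a locally injective map are countable. -/
lemma countable_inter_preimage_iterate {X : Type*} [MetricSpace X] {F : X → X} {K : Set X} {r : ℝ}
    (hr : 0 < r) (hK : IsCompact K) (hmaps : MapsTo F K K)
    (hinj : ∀ x ∈ K, InjOn F (closedBall x r)) {S : Set X} (hS : S.Countable) (n : ℕ) :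
    (K ∩ F^[n] ⁻¹' S).Countable := by
  induction n with
  | zero => exact hS.mono inter_subset_right
  | succ n ih =>
    obtain ⟨t, htK, ht, hcov⟩ := hK.finite_cover_balls hr
    refine (ht.countable.biUnion (t := fun c _ => ball c r ∩ (K ∩ F^[n + 1] ⁻¹' S))
      fun c hc => ?_).mono fun x hx => ?_
    · refine MapsTo.countable_of_injOn (f := F) (t := K ∩ F^[n] ⁻¹' S)
        (fun x hx => ⟨hmaps hx.2.1, hx.2.2⟩)
        ((hinj c (htK hc)).mono (inter_subset_left.trans ball_subset_closedBall)) ih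
    · obtain ⟨c, hc, hxc⟩ := mem_iUnion₂.1 (hcov hx.1)
      exact mem_biUnion hc ⟨hxc, hx⟩

/-- In an uncountable compact invariant set of a locally injective map, two distinct points of some
small ball return to that ball infinitely often. -/
lemma exists_ne_frequently_mem_ball {X : Type*} [MetricSpace X] {F : X → X} {K : Set X} {r ε : ℝ}
    (hr : 0 < r) (hε : 0 < ε) (hK : IsCompact K) (hmaps : MapsTo F K K)
    (hinj : ∀ x ∈ K, InjOn F (closedBall x r)) (hunc : ¬ K.Countable) :
    ∃ c, ∃ a ∈ K ∩ ball c ε, ∃ b ∈ K ∩ ball c ε, a ≠ b ∧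
      (∃ᶠ n in atTop, F^[n] a ∈ ball c ε) ∧ ∃ᶠ n in atTop, F^[n] b ∈ ball c ε := by
  by_contra! hcon
  obtain ⟨t, -, ht, hcov⟩ := hK.finite_cover_balls hε
  let S : X → Set X := fun c => {a ∈ K ∩ ball c ε | ∃ᶠ n in atTop, F^[n] a ∈ ball c ε}
  have hS : ∀ c, (S c).Subsingleton := by
    intro c a ha b hb
    by_contra hab
    exact hb.2 (hcon c a ha.1 b hb.1 hab ha.2)
  refine hunc ((ht.countable.biUnion (t := fun c _ => ⋃ n : ℕ, K ∩ F^[n] ⁻¹' S c) fun c _ =>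
    countable_iUnion fun n =>
      countable_inter_preimage_iterate hr hK hmaps hinj (hS c).countable n).mono fun x hx => ?_)
  have hfreq : ∃ c ∈ t, ∃ᶠ n in atTop, F^[n] x ∈ ball c ε := by
    by_contra! hno
    have hev : ∀ᶠ n in atTop, ∀ c ∈ t, F^[n] x ∉ ball c ε :=
      (eventually_all_finite ht).2 fun c hc => hno c hc
    obtain ⟨n, hn⟩ := hev.exists
    obtain ⟨c, hc, hxc⟩ := mem_iUnion₂.1 (hcov (hmaps.iterate n hx))
    exact hn c hc hxc
  obtain ⟨c, hc, hfr⟩ := hfreq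
  obtain ⟨n, hn⟩ := hfr.exists
  refine mem_biUnion hc (mem_iUnion.2 ⟨n, hx, ⟨hmaps.iterate n hx, hn⟩, ?_⟩)
  rw [frequently_atTop] at hfr ⊢
  intro N
  obtain ⟨k, hk, hkm⟩ := hfr (N + n)
  refine ⟨k - n, by omega, ?_⟩
  rwa [← Function.iterate_add_apply, Nat.sub_add_cancel (by omega)]

/-- An uncountable compact set on which `F` is locally expanding and locally surjective contains a
periodic point `z` and a nontrivial backward orbit `w` of the return map that converges to `z` and
whose initial point is eventually mapped to `z`. -/
lemma exists_periodic_tendsto_backward_orbit {X : Type*} [MetricSpace X] {F : X → X} {K : Set X}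
    {r : ℝ} (hr : 0 < r) (hK : IsCompact K) (hmaps : MapsTo F K K)
    (hexp : ∀ x ∈ K, ∀ u ∈ closedBall x r, ∀ v ∈ closedBall x r,
      2 * dist u v ≤ dist (F u) (F v))
    (hsurj : ∀ x ∈ K, SurjOn F (K ∩ closedBall x r) (K ∩ closedBall (F x) r))
    (hunc : ¬ K.Countable) :
    ∃ z ∈ K, ∃ n ≥ 1, F^[n] z = z ∧ ∃ w : ℕ → X, (∀ j, w j ∈ K) ∧
      (∀ j, F^[n] (w (j + 1)) = w j) ∧ Tendsto w atTop (nhds z) ∧ w 0 ≠ z ∧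
      ∃ q, F^[q] (w 0) = z := by
  have hinj : ∀ x ∈ K, InjOn F (closedBall x r) := by
    intro x hx u hu v hv huv
    have h := hexp x hx u hu v hv
    rw [huv, dist_self] at h
    exact dist_le_zero.1 (by linarith)
  obtain ⟨c, a, ha, b, hb, hab, hfa, hfb⟩ :=
    exists_ne_frequently_mem_ball hr (ε := r / 4) (by positivity) hK hmaps hinj hunc
  have hdab : 0 < dist a b := dist_pos.2 hab
  have hsmall : ∀ᶠ n : ℕ in atTop, ((1 : ℝ) / 2) ^ n * r < min (dist a b / 2) (r / 4) := by
    have h0 : Tendsto (fun n : ℕ => ((1 : ℝ) / 2) ^ n * r) atTop (nhds (0 * r)) :=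
      (tendsto_pow_atTop_nhds_zero_of_lt_one (by norm_num) (by norm_num)).mul_const r
    rw [zero_mul] at h0
    exact h0.eventually_lt_const (lt_min (by positivity) (by positivity))
  set D := K ∩ closedBall c (r / 2)
  have key : ∀ e ∈ K ∩ ball c (r / 4), (∃ᶠ n in atTop, F^[n] e ∈ ball c (r / 4)) →
      ∃ n ≥ 1, ∃ g : X → X, ∀ y ∈ D, g y ∈ D ∧ F^[n] (g y) = y ∧
        dist (g y) e < dist a b / 2 ∧ ∀ y' ∈ D, dist (g y) (g y') ≤ 1 / 2 * dist y y' := by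
    intro e he hfe
    obtain ⟨n, hnball, hnsmall, hn1⟩ :=
      (hfe.and_eventually (hsmall.and (eventually_ge_atTop 1))).exists
    obtain ⟨g, hg⟩ := exists_inverse_branch hmaps hexp hsurj n e he.1
    have hsub : D ⊆ K ∩ closedBall (F^[n] e) r := by
      refine fun y hy => ⟨hy.1, mem_closedBall.2 ?_⟩
      have h1 := mem_closedBall.1 hy.2
      have h2 := mem_ball.1 hnball
      have h3 := dist_triangle_right y (F^[n] e) c
      linarith
    refine ⟨n, hn1, g, fun y hy => ?_⟩
    obtain ⟨h1, h2, h3, h4⟩ := hg y (hsub hy)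
    have h5 : dist (g y) e < min (dist a b / 2) (r / 4) := by
      refine lt_of_le_of_lt (h3.trans ?_) hnsmall
      gcongr
      exact (hsub hy).2
    refine ⟨⟨h1, mem_closedBall.2 ?_⟩, h2, h5.trans_le (min_le_left _ _), fun y' hy' => ?_⟩
    · have h6 := h5.trans_le (min_le_right _ _)
      have h7 := mem_ball.1 he.2
      have h8 := dist_triangle (g y) e c
      linarith
    · refine (h4 y' (hsub hy')).trans ?_
      gcongr
      calc ((1 : ℝ) / 2) ^ n ≤ (1 / 2) ^ 1 :=
            pow_le_pow_of_le_one (by norm_num) (by norm_num) hn1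
        _ = 1 / 2 := pow_one _
  obtain ⟨n, hn, g, hg⟩ := key a ha hfa
  obtain ⟨q, -, h, hh⟩ := key b hb hfb
  have haD : a ∈ D := ⟨ha.1, mem_closedBall.2 ((mem_ball.1 ha.2).le.trans (by linarith))⟩
  have hgD : MapsTo g D D := fun y hy => (hg y hy).1
  have hcontr : ContractingWith (1 / 2) (hgD.restrict g D D) := by
    refine ⟨by rw [← NNReal.coe_lt_coe]; norm_num, LipschitzWith.of_dist_le_mul fun y y' => ?_⟩
    have := (hg y y.2).2.2.2 y' y'.2
    simpa [Subtype.dist_eq] using this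
  obtain ⟨z, hzD, hz, -⟩ := hcontr.exists_fixedPoint'
    (hK.inter_right isClosed_closedBall).isComplete hgD haD (edist_ne_top _ _)
  have hzg : g z = z := hz
  obtain ⟨hxD, hxz, hxb, -⟩ := hh z hzD
  have hwD : ∀ j, g^[j] (h z) ∈ D := fun j => hgD.iterate j hxD
  refine ⟨z, hzD.1, n, hn, ?_, fun j => g^[j] (h z), fun j => (hwD j).1, fun j => ?_, ?_, ?_,
    q, hxz⟩
  · have := (hg z hzD).2.1
    rwa [hzg] at this
  · simp only [Function.iterate_succ_apply']
    exact (hg _ (hwD j)).2.1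
  · have hdist : ∀ j, dist (g^[j] (h z)) z ≤ (1 / 2) ^ j * dist (h z) z := by
      intro j
      induction j with
      | zero => simp
      | succ j ih =>
        have := (hg _ (hwD j)).2.2.2 z hzD
        rw [hzg] at this
        rw [Function.iterate_succ_apply', pow_succ]
        linarith
    have h0 : Tendsto (fun j : ℕ => ((1 : ℝ) / 2) ^ j * dist (h z) z) atTop
        (nhds (0 * dist (h z) z)) :=
      (tendsto_pow_atTop_nhds_zero_of_lt_one (by norm_num) (by norm_num)).mul_const _
    rw [zero_mul] at h0
    exact tendsto_iff_dist_tendsto_zero.2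
      (squeeze_zero (fun _ => dist_nonneg) hdist h0)
  · intro hcon
    have hza := (hg z hzD).2.2.1
    rw [hzg] at hza
    have hzb : dist z b < dist a b / 2 := by
      rw [← hcon]; exact hxb
    have := dist_triangle_left a b z
    linarith

/-- A backward orbit of `f^[p]` converging to a fixed point `z` of `f^[p]`, whose initial point
differs from `z` but is eventually mapped to `z`, extends to a homoclinic orbit of `f`. -/
lemma exists_homoclinic_orbit {X : Type*} [MetricSpace X] {f : X → X} (hf : Continuous f)
    {K : Set X} (hmaps : MapsTo f K K) {z : X} {p : ℕ} (hp : 1 ≤ p) (hz : f^[p] z = z)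
    {w : ℕ → X} (hwK : ∀ j, w j ∈ K) (hw : ∀ j, f^[p] (w (j + 1)) = w j)
    (hlim : Tendsto w atTop (nhds z)) (hne : w 0 ≠ z) {q : ℕ} (hq : f^[q] (w 0) = z) :
    ∃ x : ℤ → X, (∀ n, x n ∈ K) ∧ (∀ n, f (x (n + 1)) = x n) ∧
      Tendsto (fun n => infDist (x n) {y | ∃ i < p, y = f^[i] z}) atTop (nhds 0) ∧
      Tendsto (fun n => infDist (x n) {y | ∃ i < p, y = f^[i] z}) atBot (nhds 0) ∧
      ∃ N, x N ∉ {y | ∃ i < p, y = f^[i] z} := by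
  set γ : Set X := {y | ∃ i < p, y = f^[i] z}
  have hmul : ∀ j, f^[p * j] (w j) = w 0 := by
    intro j
    induction j with
    | zero => simp
    | succ j ih => rw [Nat.mul_succ, Function.iterate_add_apply, hw, ih]
  have hzmul : ∀ j, f^[p * j] z = z := by
    intro j
    induction j with
    | zero => simp
    | succ j ih => rw [Nat.mul_succ, Function.iterate_add_apply, hz, ih]
  have hzγ : ∀ i, f^[i] z ∈ γ := by
    intro i
    refine ⟨i % p, Nat.mod_lt _ hp, ?_⟩
    conv_lhs => rw [← Nat.mod_add_div i p, Function.iterate_add_apply, hzmul]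
  have hγfin : γ.Finite := by
    refine ((finite_Iio p).image fun i => f^[i] z).subset ?_
    rintro y ⟨i, hi, rfl⟩
    exact ⟨i, hi, rfl⟩
  let x : ℤ → X := fun n => f^[(p * n.toNat - n).toNat] (w n.toNat)
  have hxnat : ∀ n : ℕ, x n = f^[p * n - n] (w n) := by
    intro n
    simp only [x, Int.toNat_natCast]
    congr 2
    omega
  have hxneg : ∀ n : ℕ, x (-n) = f^[n] (w 0) := by
    intro n
    simp [x]
  have hshift : ∀ n j k : ℕ, n ≤ p * j → f^[p * (j + k) - n] (w (j + k)) = f^[p * j - n] (w j) := by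
    intro n j k hn
    induction k with
    | zero => rfl
    | succ k ih =>
      have hle : p * j ≤ p * (j + k) := Nat.mul_le_mul_left _ (Nat.le_add_right _ _)
      rw [← ih, ← add_assoc, Nat.mul_succ,
        show p * (j + k) + p - n = (p * (j + k) - n) + p by omega, Function.iterate_add_apply, hw]
  refine ⟨x, fun n => hmaps.iterate _ (hwK _), fun n => ?_, ?_, ?_, ?_⟩
  · obtain ⟨m, rfl | rfl⟩ := n.eq_nat_or_neg
    · have h1 : x ((m : ℤ) + 1) = f^[p * (m + 1) - (m + 1)] (w (m + 1)) := by
        exact_mod_cast hxnat (m + 1)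
      have hle : m ≤ p * m := Nat.le_mul_of_pos_left m hp
      rw [h1, hxnat, ← Function.iterate_succ_apply' f, Nat.mul_succ,
        show (p * m + p - (m + 1)).succ = (p * m - m) + p by omega,
        Function.iterate_add_apply, hw]
    · cases m with
      | zero =>
        have h1 := hxnat 1
        have h2 := hxneg 0
        simp only [Nat.cast_one, Nat.cast_zero, neg_zero, mul_one, Function.iterate_zero,
          id_eq] at h1 h2
        simp only [Nat.cast_zero, neg_zero, zero_add]
        rw [h1, h2, ← Function.iterate_succ_apply' f, show (p - 1).succ = p by omega, hw]
      | succ m =>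
        rw [show (-((m + 1 : ℕ) : ℤ) + 1) = -(m : ℤ) by push_cast; ring, hxneg, hxneg,
          ← Function.iterate_succ_apply' f]
  · rw [Metric.tendsto_atTop]
    intro ε hε
    have hev : ∀ᶠ j in atTop, ∀ s ∈ Iio p, dist (f^[s] (w j)) (f^[s] z) < ε := by
      refine (eventually_all_finite (finite_Iio p)).2 fun s _ => ?_
      exact (((hf.iterate s).tendsto z).comp hlim).eventually (ball_mem_nhds _ hε)
    obtain ⟨J, hJ⟩ := eventually_atTop.1 hev
    refine ⟨(p * J : ℕ), fun n hn => ?_⟩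
    lift n to ℕ using (by positivity : (0 : ℤ) ≤ (p * J : ℕ)).trans hn
    have hn' : p * J ≤ n := by exact_mod_cast hn
    have hdm := Nat.div_add_mod n p
    have hml := Nat.mod_lt n hp
    obtain ⟨j, hjJ, hnj, hs⟩ : ∃ j ≥ J, n ≤ p * j ∧ p * j - n < p := by
      rcases Nat.eq_zero_or_pos (n % p) with h0 | h0
      · exact ⟨n / p, (Nat.le_div_iff_mul_le hp).2 (by rwa [mul_comm]), by omega, by omega⟩
      · refine ⟨n / p + 1, ?_, ?_, ?_⟩
        · exact ((Nat.le_div_iff_mul_le hp).2 (by rwa [mul_comm])).trans (Nat.le_succ _)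
        · rw [Nat.mul_succ]; omega
        · rw [Nat.mul_succ]; omega
    have hjn : j ≤ n := by
      by_contra! hlt
      have h1 : p * (n + 1) ≤ p * j := Nat.mul_le_mul_left _ hlt
      have h2 : n ≤ p * n := Nat.le_mul_of_pos_left n hp
      rw [Nat.mul_succ] at h1
      omega
    obtain ⟨k, rfl⟩ := Nat.exists_eq_add_of_le hjn
    have hx : x ((j + k : ℕ) : ℤ) = f^[p * j - (j + k)] (w j) := by
      rw [hxnat, hshift _ _ _ hnj]
    rw [hx, Real.dist_0_eq_abs, abs_of_nonneg infDist_nonneg]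
    exact (infDist_le_dist_of_mem (hzγ _)).trans_lt (hJ j hjJ _ hs)
  · refine tendsto_const_nhds.congr' ?_
    filter_upwards [eventually_le_atBot (-(q : ℤ))] with n hn
    obtain ⟨k, hk⟩ := Int.eq_ofNat_of_zero_le (show 0 ≤ -(q : ℤ) - n by omega)
    have hnk : n = -((k + q : ℕ) : ℤ) := by push_cast; omega
    rw [hnk, hxneg, Function.iterate_add_apply, hq, infDist_zero_of_mem (hzγ k)]
  · by_contra! hcon
    have hwγ : ∀ j, w j ∈ γ := by
      intro j
      have h := hxnat (p * j)
      have hle : j ≤ p * j := Nat.le_mul_of_pos_left j hp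
      obtain ⟨k, hk⟩ := Nat.exists_eq_add_of_le hle
      have h2 := hshift (p * j) j k le_rfl
      rw [← hk, Nat.sub_self, Function.iterate_zero, id_eq] at h2
      rw [← h2, ← h]
      exact hcon _
    have hnhds : (γ \ {z})ᶜ ∈ nhds z :=
      (hγfin.subset sdiff_subset).isClosed.isOpen_compl.mem_nhds (by simp)
    obtain ⟨j, hj⟩ := (hlim.eventually hnhds).exists
    have hjz : w j = z := by
      by_contra hne'
      exact hj ⟨hwγ j, hne'⟩
    exact hne (by rw [← hmul j, hjz, hzmul])

/-- An isolated compact invariant set is locally maximal for the iterates of the map: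
local preimages of points of `K` lie in `K`. -/
lemma exists_radius_mem_of_iterate_mem {X : Type*} [MetricSpace X] {f : X → X}
    (hf : Continuous f) {K U : Set X} (hK : IsCompact K) (hmaps : MapsTo f K K)
    (hU : IsOpen U) (hKU : K ⊆ U) (hiso : K = ⋂ n : ℕ, f^[n] ⁻¹' U) (m : ℕ) :
    ∃ R > 0, ∀ x ∈ K, ∀ u ∈ closedBall x R, f^[m] u ∈ K → u ∈ K := by
  have hVopen : IsOpen (⋂ j ∈ Iio m, f^[j] ⁻¹' U) :=
    (finite_Iio m).isOpen_biInter fun j _ => hU.preimage (hf.iterate j)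
  have hKV : K ⊆ ⋂ j ∈ Iio m, f^[j] ⁻¹' U :=
    fun x hx => mem_iInter₂.2 fun j _ => hKU (hmaps.iterate j hx)
  obtain ⟨R, hR, hRV⟩ := hK.exists_cthickening_subset_open hVopen hKV
  refine ⟨R, hR, fun x hx u hu hmu => ?_⟩
  have huV := mem_iInter₂.1 (hRV (closedBall_subset_cthickening hx R hu))
  rw [hiso]
  refine mem_iInter.2 fun n => ?_
  rcases lt_or_ge n m with hn | hn
  · exact huV n hn
  · obtain ⟨k, rfl⟩ := Nat.exists_eq_add_of_le hn
    change f^[m + k] u ∈ U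
    rw [add_comm, Function.iterate_add_apply]
    exact hKU (hmaps.iterate k hmu)

/-- An uncountable expanding set of a `C¹` map of `ℝ^d` contains
an expanding periodic orbit together with an associated homoclinic orbit all of
whose points lie in `K`. -/
theorem uncountable_expanding_set_has_homoclinic_orbit
    (d : ℕ) (hd : 1 ≤ d)
    (f : EuclideanSpace ℝ (Fin d) → EuclideanSpace ℝ (Fin d))
    (hf : ContDiff ℝ 1 f)
    (K : Set (EuclideanSpace ℝ (Fin d)))
    (hKcomp : IsCompact K) (hKinv : f '' K = K)
    (hKexp : ∃ C > (0 : ℝ), ∃ lam > (1 : ℝ), ∀ y ∈ K,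
      ∀ v : EuclideanSpace ℝ (Fin d), ∀ n : ℕ, 1 ≤ n →
        C * lam ^ n * ‖v‖ ≤ ‖fderiv ℝ (f^[n]) y v‖)
    (hKiso : ∃ U : Set (EuclideanSpace ℝ (Fin d)), IsOpen U ∧ K ⊆ U ∧
      K = ⋂ n : ℕ, f^[n] ⁻¹' U)
    (hKunc : ¬ K.Countable) :
    ∃ z ∈ K, ∃ k : ℕ, 1 ≤ k ∧ f^[k] z = z ∧
      (∃ lam > (1 : ℝ), ∀ v : EuclideanSpace ℝ (Fin d),
        lam * ‖v‖ ≤ ‖fderiv ℝ (f^[k]) z v‖) ∧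
      ∃ γ : Set (EuclideanSpace ℝ (Fin d)),
        γ = {y | ∃ i < k, y = f^[i] z} ∧
        ∃ x : ℤ → EuclideanSpace ℝ (Fin d),
          (∀ n : ℤ, x n ∈ K) ∧
          (∀ n : ℤ, f (x (n + 1)) = x n) ∧
          Tendsto (fun n : ℤ => infDist (x n) γ) atTop (nhds 0) ∧
          Tendsto (fun n : ℤ => infDist (x n) γ) atBot (nhds 0) ∧
          ∃ N : ℤ, x N ∉ γ := by
  obtain ⟨C, hC, lam, hlam, hexp⟩ := hKexp
  obtain ⟨U, hU, hKU, hiso⟩ := hKiso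
  have hmaps : MapsTo f K K := mapsTo_iff_image_subset.2 hKinv.subset
  have hcont : Continuous f := hf.continuous
  obtain ⟨m, hm4, hm1⟩ : ∃ m : ℕ, 4 ≤ C * lam ^ m ∧ 1 ≤ m :=
    ((((tendsto_pow_atTop_atTop_of_one_lt hlam).const_mul_atTop hC).eventually_ge_atTop 4).and
      (eventually_ge_atTop 1)).exists
  have hexp4 : ∀ p, m ≤ p → ∀ y ∈ K, ∀ v, 4 * ‖v‖ ≤ ‖fderiv ℝ (f^[p]) y v‖ := by
    intro p hp y hy v
    refine le_trans ?_ (hexp y hy v p (hm1.trans hp))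
    gcongr
    refine hm4.trans ?_
    gcongr
    exact hlam.le
  have hfm : ContDiff ℝ 1 f^[m] := by
    clear hm4 hm1 hexp4
    induction m with
    | zero => exact contDiff_id
    | succ m ih => exact ih.comp hf
  obtain ⟨R₁, hR₁, hloc⟩ :=
    exists_radius_expanding_surjOn hfm hKcomp (hexp4 m le_rfl)
  obtain ⟨R₂, hR₂, hmax⟩ :=
    exists_radius_mem_of_iterate_mem hcont hKcomp hmaps hU hKU hiso m
  have hr : 0 < min R₁ R₂ := lt_min hR₁ hR₂
  obtain ⟨z, hzK, n, hn, hz, w, hwK, hw, hlim, hne, q, hq⟩ :=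
    exists_periodic_tendsto_backward_orbit hr hKcomp (hmaps.iterate m)
      (fun x hx => (hloc _ hr (min_le_left _ _) x hx).1)
      (fun x hx y hy => by
        obtain ⟨u, hu, hFu⟩ := (hloc _ hr (min_le_left _ _) x hx).2
          (closedBall_subset_closedBall (by linarith) hy.2)
        exact ⟨u, ⟨hmax x hx u (closedBall_subset_closedBall (min_le_right _ _) hu)
          (hFu ▸ hy.1), hu⟩, hFu⟩) hKunc
  simp only [← Function.iterate_mul] at hz hw hq
  have hmn : m ≤ m * n := Nat.le_mul_of_pos_right m hn
  obtain ⟨x, hx⟩ := exists_homoclinic_orbit hcont hmaps (hm1.trans hmn) hz hwK hw hlim hne hq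
  exact ⟨z, hzK, m * n, hm1.trans hmn, hz, ⟨4, by norm_num, hexp4 _ hmn z hzK⟩, _, rfl, x, hx⟩
end

section
/- Let d ≥ 1, let f : ℝ^d → ℝ^d be a C^1 map and let K be a nonempty expanding set for f which is transitive, i.e. there is x ∈ K whose forward orbit {f^n(x) : n ≥ 0} is dense in K. Then for every periodic orbit γ ⊆ K of f, K equals the closure of the set of points y ∈ K such that f^n(y) ∈ γ for some n ≥ 0 and y has a preorbit (y_m)_{m≥0} with dist(y_m, γ) → 0 as m → ∞ (i.e. K = clos(∪_{n≥0} f^{−n}(γ) ∩ W^u(γ) ∩ K)). -/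
open Filter Metric Set

section ExpandingSets

variable {E : Type*} [NormedAddCommGroup E] [NormedSpace ℝ E] [FiniteDimensional ℝ E]

/-- An injective linear endomorphism of a finite-dimensional space which expands all vectors by
`c > 0` has a right inverse of norm at most `c⁻¹`. -/
lemma exists_nonlinearRightInverse_of_le_norm (A : E →L[ℝ] E) {c : NNReal} (hc : 0 < c)
    (hA : ∀ v, c * ‖v‖ ≤ ‖A v‖) : ∃ B : A.NonlinearRightInverse, B.nnnorm = c⁻¹ := by
  have hc' : (0 : ℝ) < c := hc
  have hinj : Function.Injective (A : E →ₗ[ℝ] E) := by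
    rw [injective_iff_map_eq_zero]
    intro v hv
    have h := hA v
    have hv' : A v = 0 := hv
    rw [hv', norm_zero] at h
    exact norm_le_zero_iff.1 (nonpos_of_mul_nonpos_right h hc')
  have hsurj : Function.Surjective A := LinearMap.injective_iff_surjective.1 hinj
  choose g hg using hsurj
  refine ⟨⟨g, c⁻¹, fun y => ?_, hg⟩, rfl⟩
  have h := hA (g y)
  rw [hg] at h
  rw [NNReal.coe_inv, inv_mul_eq_div, le_div_iff₀ hc']
  linarith

/-- Finitely many iterates of a continuous map are equicontinuous, uniformly at the points of
a compact set. -/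
lemma exists_pos_forall_dist_iterate_lt {X : Type*} [PseudoMetricSpace X]
    {f : X → X} (hf : Continuous f) {K : Set X}
    (hK : IsCompact K) (M : ℕ) {ε : ℝ} (hε : 0 < ε) :
    ∃ η > 0, ∀ x ∈ K, ∀ y, dist y x ≤ η → ∀ i ≤ M, dist (f^[i] y) (f^[i] x) < ε := by
  have h : ∀ i ∈ Finset.range (M + 1),
      ∀ᶠ q : X × X in uniformity X, q.1 ∈ K → dist (f^[i] q.1) (f^[i] q.2) < ε := fun i _ =>
    hK.uniformContinuousAt_of_continuousAt (f^[i])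
      (fun a _ => (hf.iterate i).continuousAt) (dist_mem_uniformity hε)
  obtain ⟨η, hη, H⟩ := mem_uniformity_dist.1 ((Finset.eventually_all _).2 h)
  refine ⟨η / 2, by positivity, fun x hx y hxy i hi => ?_⟩
  rw [dist_comm]
  have : dist x y < η := by rw [dist_comm]; linarith
  exact H this i (Finset.mem_range.2 (by omega)) hx

/-- A `C¹` map whose derivative expands by `4` at the points of a compact set `K` covers, near
every point of `K`, balls of twice the radius. -/
lemma exists_pos_forall_exists_preimage_dist_le {F : E → E} (hF : ContDiff ℝ 1 F) {K : Set E}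
    (hK : IsCompact K) (hexp : ∀ x ∈ K, ∀ v, 4 * ‖v‖ ≤ ‖fderiv ℝ F x v‖) :
    ∃ δ > 0, ∀ x ∈ K, ∀ w, dist w (F x) ≤ δ → ∃ y, F y = w ∧ dist y x ≤ dist w (F x) / 2 := by
  have hcont : Continuous (fderiv ℝ F) := hF.continuous_fderiv one_ne_zero
  obtain ⟨η, hη, H⟩ := mem_uniformity_dist.1 (hK.uniformContinuousAt_of_continuousAt (fderiv ℝ F)
    (fun a _ => hcont.continuousAt) (dist_mem_uniformity one_pos))
  refine ⟨η, hη, fun x hx w hw => ?_⟩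
  set r := dist w (F x) / 2 with hr
  have hr0 : 0 ≤ r := by positivity
  obtain ⟨B, hB⟩ := exists_nonlinearRightInverse_of_le_norm (fderiv ℝ F x) (c := 4) (by norm_num)
    (by simpa using hexp x hx)
  have happ : ApproximatesLinearOn F (fderiv ℝ F x) (closedBall x r) 1 := by
    intro y hy y' hy'
    refine (convex_closedBall x r).norm_image_sub_le_of_norm_fderiv_le' (𝕜 := ℝ)
      (fun t _ => (hF.differentiable one_ne_zero).differentiableAt) (fun t ht => ?_) hy' hy
    have ht' : dist x t < η := by
      rw [dist_comm]
      have := mem_closedBall.1 ht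
      linarith
    have := H ht' hx
    rw [mem_ofPred_eq, dist_comm, dist_eq_norm] at this
    simpa using this.le
  have hs := happ.surjOn_closedBall_of_nonlinearRightInverse B hr0 subset_rfl
  obtain ⟨y, hy, hyw⟩ := hs (a := w) (by
    rw [hB, mem_closedBall]
    push_cast
    rw [inv_inv]
    linarith)
  exact ⟨y, hyw, mem_closedBall.1 hy⟩

lemma iterate_mem_of_image_eq {α : Type*} {f : α → α} {K : Set α} (hinv : f '' K = K) (n : ℕ)
    {x : α} (hx : x ∈ K) : f^[n] x ∈ K :=
  (mapsTo_iff_image_subset.2 hinv.subset).iterate n hx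

/-- For an isolated set on which some iterate `f^[M]` expands, the local inverse branches of
`f^[M]` preserve the set. -/
lemma exists_pos_forall_mem_exists_preimage_mem {f : E → E} (hf : ContDiff ℝ 1 f) {K U : Set E}
    (hK : IsCompact K) (hinv : f '' K = K) (hU : IsOpen U) (hKU : K ⊆ U)
    (hiso : K = ⋂ n : ℕ, f^[n] ⁻¹' U) {M : ℕ}
    (hexp : ∀ x ∈ K, ∀ v, 4 * ‖v‖ ≤ ‖fderiv ℝ (f^[M]) x v‖) :
    ∃ δ > 0, ∀ x ∈ K, ∀ w ∈ K, dist w (f^[M] x) ≤ δ →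
      ∃ y ∈ K, f^[M] y = w ∧ dist y x ≤ dist w (f^[M] x) / 2 := by
  have hfM : ContDiff ℝ 1 f^[M] := by
    clear hexp
    induction M with
    | zero => exact contDiff_id
    | succ M ih => exact ih.comp hf
  obtain ⟨δ₁, hδ₁, H₁⟩ := exists_pos_forall_exists_preimage_dist_le hfM hK hexp
  obtain ⟨ρ, hρ, hρU⟩ := hK.exists_thickening_subset_open hU hKU
  obtain ⟨δ₂, hδ₂, H₂⟩ := exists_pos_forall_dist_iterate_lt hf.continuous hK M hρ
  refine ⟨min δ₁ δ₂, lt_min hδ₁ hδ₂, fun x hx w hw hwx => ?_⟩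
  obtain ⟨y, hyw, hyx⟩ := H₁ x hx w (hwx.trans (min_le_left _ _))
  refine ⟨y, ?_, hyw, hyx⟩
  have hyx₂ : dist y x ≤ δ₂ := by
    have := hwx.trans (min_le_right _ _)
    have := dist_nonneg (x := w) (y := f^[M] x)
    linarith
  rw [hiso, mem_iInter]
  intro n
  rcases le_total n M with hn | hn
  · exact hρU (mem_thickening_iff.2
      ⟨f^[n] x, iterate_mem_of_image_eq hinv n hx, H₂ x hx y hyx₂ n hn⟩)
  · obtain ⟨j, rfl⟩ := Nat.exists_eq_add_of_le' hn
    rw [mem_preimage, Function.iterate_add_apply, hyw]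
    exact hKU (iterate_mem_of_image_eq hinv j hw)

/-- If `f^[M]` has contracting inverse branches on `K`, then the iterates `f^[n]` on `K` are
uniformly open, uniformly in `n`. -/
lemma exists_pos_forall_exists_iterate_eq_dist_lt {X : Type*} [PseudoMetricSpace X]
    {f : X → X} (hf : Continuous f) {K : Set X}
    (hK : IsCompact K) (hinv : f '' K = K) {M : ℕ} (hM : 0 < M) {δ : ℝ} (hδ : 0 < δ)
    (hlift : ∀ x ∈ K, ∀ w ∈ K, dist w (f^[M] x) ≤ δ →
      ∃ y ∈ K, f^[M] y = w ∧ dist y x ≤ dist w (f^[M] x) / 2) {ε : ℝ} (hε : 0 < ε) :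
    ∃ η > 0, ∀ n : ℕ, ∀ x ∈ K, ∀ w ∈ K, dist w (f^[n] x) ≤ η →
      ∃ y ∈ K, f^[n] y = w ∧ dist y x < ε := by
  obtain ⟨η, hη, H⟩ := exists_pos_forall_dist_iterate_lt hf hK M hε
  have hiter : ∀ q : ℕ, ∀ x ∈ K, ∀ w ∈ K, dist w (f^[M * q] x) ≤ δ →
      ∃ y ∈ K, f^[M * q] y = w ∧ dist y x ≤ dist w (f^[M * q] x) := by
    intro q
    induction q with
    | zero => exact fun x _ w hw _ => ⟨w, hw, rfl, le_rfl⟩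
    | succ q ih =>
      intro x hx w hw hwx
      rw [mul_add, mul_one, Function.iterate_add_apply] at hwx ⊢
      obtain ⟨u, hu, huw, hux⟩ := ih _ (iterate_mem_of_image_eq hinv M hx) w hw hwx
      obtain ⟨y, hy, hyu, hyx⟩ := hlift x hx u hu (hux.trans hwx)
      refine ⟨y, hy, by rw [Function.iterate_add_apply, hyu, huw], ?_⟩
      have := dist_nonneg (x := u) (y := f^[M] x)
      linarith
  refine ⟨min η δ, lt_min hη hδ, fun n x hx w hw hwx => ?_⟩
  obtain ⟨j, hj, q, hq⟩ : ∃ j ≤ M, ∃ q, n + j = M * q := by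
    refine ⟨M - n % M, Nat.sub_le _ _, n / M + 1, ?_⟩
    have h₁ := Nat.div_add_mod n M
    have h₂ := Nat.mod_lt n hM
    rw [mul_add, mul_one]
    omega
  have hsurj : SurjOn f K K := hinv.superset
  obtain ⟨x', hx', rfl⟩ := hsurj.iterate j hx
  rw [← Function.iterate_add_apply, hq] at hwx
  obtain ⟨y, hy, hyw, hyx⟩ := hiter q x' hx' w hw (hwx.trans (min_le_right _ _))
  refine ⟨f^[j] y, iterate_mem_of_image_eq hinv j hy, ?_,
    H x' hx' y (hyx.trans (hwx.trans (min_le_left _ _))) j hj⟩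
  rw [← Function.iterate_add_apply, hq, hyw]

/-- A dense forward orbit in a set with `f '' K = K` visits every open set meeting `K` at
arbitrarily late times. -/
lemma exists_ge_dist_iterate_lt {X : Type*} [PseudoMetricSpace X]
    {f : X → X} (hf : Continuous f) {K : Set X}
    (hinv : f '' K = K) {x₀ : X} (hx₀ : K ⊆ closure {y | ∃ n : ℕ, f^[n] x₀ = y})
    (m : ℕ) {q : X} (hq : q ∈ K) {ε : ℝ} (hε : 0 < ε) :
    ∃ n ≥ m, dist (f^[n] x₀) q < ε := by
  have key : K ⊆ closure {y | ∃ n ≥ m, f^[n] x₀ = y} := by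
    induction m with
    | zero => simpa using hx₀
    | succ m ih =>
      calc K = f '' K := hinv.symm
        _ ⊆ f '' closure {y | ∃ n ≥ m, f^[n] x₀ = y} := image_mono ih
        _ ⊆ closure (f '' {y | ∃ n ≥ m, f^[n] x₀ = y}) := image_closure_subset_closure_image hf
        _ ⊆ _ := closure_mono (by
          rintro _ ⟨_, ⟨n, hn, rfl⟩, rfl⟩
          exact ⟨n + 1, Nat.succ_le_succ hn, Function.iterate_succ_apply' f n x₀⟩)
  obtain ⟨_, ⟨n, hn, rfl⟩, h⟩ := mem_closure_iff.1 (key hq) ε hε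
  exact ⟨n, hn, by rwa [dist_comm]⟩

/-- If `z` is fixed by `f^[M]` and `f^[M]` has contracting inverse branches on `K`, then the points
of `K` near `z` have preorbits converging to any set containing the orbit of `z`. -/
lemma exists_preorbit_tendsto_infDist {X : Type*} [PseudoMetricSpace X]
    {f : X → X} (hf : Continuous f) {K γ : Set X} {M : ℕ}
    (hM : 0 < M) {δ : ℝ}
    (hlift : ∀ x ∈ K, ∀ w ∈ K, dist w (f^[M] x) ≤ δ →
      ∃ y ∈ K, f^[M] y = w ∧ dist y x ≤ dist w (f^[M] x) / 2)
    {z : X} (hz : z ∈ K) (hfix : f^[M] z = z) (hγ : ∀ n : ℕ, f^[n] z ∈ γ)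
    {w : X} (hw : w ∈ K) (hwz : dist w z ≤ δ) :
    ∃ s : ℕ → X, s 0 = w ∧ (∀ m : ℕ, f (s (m + 1)) = s m) ∧
      Tendsto (fun m : ℕ => infDist (s m) γ) atTop (nhds 0) := by
  have hstep : ∀ u : {u : X // u ∈ K ∧ dist u z ≤ δ}, ∃ u' : {u : X // u ∈ K ∧ dist u z ≤ δ},
      f^[M] u' = u ∧ dist (u' : X) z ≤ dist (u : X) z / 2 := by
    rintro ⟨u, hu, huz⟩
    obtain ⟨y, hy, hyu, hyz⟩ := hlift z hz u hu (by rwa [hfix])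
    rw [hfix] at hyz
    have := dist_nonneg (x := u) (y := z)
    exact ⟨⟨y, hy, by linarith⟩, hyu, hyz⟩
  choose g hg hgz using hstep
  let v : ℕ → {u : X // u ∈ K ∧ dist u z ≤ δ} := fun j => g^[j] ⟨w, hw, hwz⟩
  have hv : ∀ j, f^[M] (v (j + 1)) = v j := fun j => by
    simp only [v, Function.iterate_succ_apply', hg]
  have hvz : ∀ j, dist (v j : X) z ≤ dist w z * (1 / 2) ^ j := by
    intro j
    induction j with
    | zero => simp [v]
    | succ j ih =>
      have := hgz (v j)
      rw [pow_succ]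
      simp only [v, Function.iterate_succ_apply'] at this ih ⊢
      linarith
  have hlim : Tendsto (fun j => (v j : X)) atTop (nhds z) := by
    rw [tendsto_iff_dist_tendsto_zero]
    refine squeeze_zero (fun _ => dist_nonneg) hvz ?_
    simpa using (tendsto_pow_atTop_nhds_zero_of_lt_one (r := (1 / 2 : ℝ)) (by norm_num)
      (by norm_num)).const_mul (dist w z)
  have hback : ∀ j i, f^[M * i] (v (j + i)) = v j := by
    intro j i
    induction i with
    | zero => rfl
    | succ i ih => rw [mul_add, mul_one, Function.iterate_add_apply, ← add_assoc, hv, ih]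
  have hs : ∀ m j, m ≤ M * j → f^[M * m - m] (v m) = f^[M * j - m] (v j) := by
    intro m j hmj
    have hm : m ≤ M * m := Nat.le_mul_of_pos_left m hM
    rcases le_total m j with h | h
    · obtain ⟨i, rfl⟩ := Nat.exists_eq_add_of_le h
      rw [← hback m i, ← Function.iterate_add_apply]
      congr 2
      rw [mul_add]
      omega
    · obtain ⟨i, rfl⟩ := Nat.exists_eq_add_of_le h
      rw [← hback j i, ← Function.iterate_add_apply]
      congr 2
      rw [mul_add] at hm ⊢
      omega
  refine ⟨fun m => f^[M * m - m] (v m), rfl, fun m => ?_, ?_⟩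
  · have hm : m + 1 ≤ M * (m + 1) := Nat.le_mul_of_pos_left _ hM
    beta_reduce
    rw [← Function.iterate_succ_apply' f, hs m (m + 1) (by omega)]
    congr 1
    omega
  · rw [Metric.tendsto_atTop]
    intro ε hε
    obtain ⟨η, hη, H⟩ := exists_pos_forall_dist_iterate_lt hf (isCompact_singleton (x := z)) M hε
    obtain ⟨J, hJ⟩ := Metric.tendsto_atTop.1 hlim η hη
    refine ⟨M * J, fun m hm => ?_⟩
    have h₁ := Nat.div_add_mod m M
    have h₂ := Nat.mod_lt m hM
    have h₃ : J ≤ m / M := (Nat.le_div_iff_mul_le hM).2 (by rwa [mul_comm])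
    have h₄ : M * (m / M + 1) = M * (m / M) + M := by ring
    beta_reduce
    rw [Real.dist_0_eq_abs, abs_of_nonneg infDist_nonneg, hs m (m / M + 1) (by omega)]
    exact (infDist_le_dist_of_mem (hγ _)).trans_lt
      (H z rfl _ (hJ _ (by omega)).le _ (by omega))

/-- Forward images of points with a preorbit converging to `γ` have such a preorbit. -/
lemma exists_preorbit_iterate {X : Type*} [PseudoMetricSpace X]
    {f : X → X} {γ : Set X} {w : X}
    (h : ∃ s : ℕ → X, s 0 = w ∧ (∀ m : ℕ, f (s (m + 1)) = s m) ∧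
      Tendsto (fun m : ℕ => infDist (s m) γ) atTop (nhds 0)) (a : ℕ) :
    ∃ s : ℕ → X, s 0 = f^[a] w ∧ (∀ m : ℕ, f (s (m + 1)) = s m) ∧
      Tendsto (fun m : ℕ => infDist (s m) γ) atTop (nhds 0) := by
  induction a with
  | zero => exact h
  | succ a ih =>
    obtain ⟨s, hs₀, hs, hlim⟩ := ih
    refine ⟨fun m => Nat.casesOn m (f (s 0)) s, ?_, ?_, ?_⟩
    · simp [hs₀, Function.iterate_succ_apply']
    · rintro (_ | m)
      · rfl
      · exact hs m
    · exact (tendsto_add_atTop_iff_nat 1).1 hlim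

end ExpandingSets

/-- If `K` is a nonempty transitive expanding set of a `C¹` map
of `ℝ^d`, then for every periodic orbit `γ ⊆ K` one has
`K = clos(∪_{n≥0} f^{-n}(γ) ∩ W^u(γ) ∩ K)`. -/
theorem transitive_expanding_set_eq_closure_homoclinic_points
    (d : ℕ) (hd : 1 ≤ d)
    (f : EuclideanSpace ℝ (Fin d) → EuclideanSpace ℝ (Fin d))
    (hf : ContDiff ℝ 1 f)
    (K : Set (EuclideanSpace ℝ (Fin d)))
    (hKne : K.Nonempty)
    (hKcomp : IsCompact K) (hKinv : f '' K = K)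
    (hKexp : ∃ C > (0 : ℝ), ∃ lam > (1 : ℝ), ∀ y ∈ K,
      ∀ v : EuclideanSpace ℝ (Fin d), ∀ n : ℕ, 1 ≤ n →
        C * lam ^ n * ‖v‖ ≤ ‖fderiv ℝ (f^[n]) y v‖)
    (hKiso : ∃ U : Set (EuclideanSpace ℝ (Fin d)), IsOpen U ∧ K ⊆ U ∧
      K = ⋂ n : ℕ, f^[n] ⁻¹' U)
    (hKtrans : ∃ x₀ ∈ K, K ⊆ closure {y | ∃ n : ℕ, f^[n] x₀ = y})
    -- a periodic orbit γ contained in K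
    (z : EuclideanSpace ℝ (Fin d)) (hzK : z ∈ K)
    (k : ℕ) (hk : 1 ≤ k) (hper : f^[k] z = z)
    (γ : Set (EuclideanSpace ℝ (Fin d)))
    (hγ : γ = {y | ∃ i < k, y = f^[i] z}) (hγK : γ ⊆ K) :
    K = closure {y | y ∈ K ∧ (∃ n : ℕ, f^[n] y ∈ γ) ∧
      ∃ s : ℕ → EuclideanSpace ℝ (Fin d), s 0 = y ∧
        (∀ m : ℕ, f (s (m + 1)) = s m) ∧
        Tendsto (fun m : ℕ => infDist (s m) γ) atTop (nhds 0)} := by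
  obtain ⟨C, hC, lam, hlam, hexp⟩ := hKexp
  obtain ⟨U, hU, hKU, hiso⟩ := hKiso
  obtain ⟨x₀, hx₀, hdense⟩ := hKtrans
  have hcont : Continuous f := hf.continuous
  have horbit : ∀ n : ℕ, f^[n] z ∈ γ := fun n => by
    rw [hγ]
    exact ⟨n % k, Nat.mod_lt n hk, (Function.IsPeriodicPt.iterate_mod_apply hper n).symm⟩
  obtain ⟨M, hM, hfix, hfour⟩ : ∃ M > 0, f^[M] z = z ∧
      ∀ x ∈ K, ∀ v, 4 * ‖v‖ ≤ ‖fderiv ℝ (f^[M]) x v‖ := by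
    obtain ⟨n, hn⟩ := pow_unbounded_of_one_lt (4 / C) hlam
    have hM : 0 < k * (n + 1) := by positivity
    refine ⟨k * (n + 1), hM, Function.IsPeriodicPt.mul_const hper (n + 1), fun x hx v => ?_⟩
    have hle : lam ^ n ≤ lam ^ (k * (n + 1)) := pow_le_pow_right₀ hlam.le (by nlinarith)
    have h4 : 4 ≤ C * lam ^ (k * (n + 1)) := by
      rw [div_lt_iff₀ hC] at hn
      nlinarith
    exact (mul_le_mul_of_nonneg_right h4 (norm_nonneg v)).trans (hexp x hx v _ hM)
  obtain ⟨δ, hδ, hlift⟩ :=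
    exists_pos_forall_mem_exists_preimage_mem hf hKcomp hKinv hU hKU hiso hfour
  refine Subset.antisymm (fun p hp => ?_)
    (closure_minimal (fun y hy => hy.1) hKcomp.isClosed)
  rw [Metric.mem_closure_iff]
  intro ε hε
  obtain ⟨η₁, hη₁, H₁⟩ := exists_pos_forall_exists_iterate_eq_dist_lt hcont hKcomp hKinv hM hδ
    hlift (half_pos hδ)
  obtain ⟨η₂, hη₂, H₂⟩ := exists_pos_forall_exists_iterate_eq_dist_lt hcont hKcomp hKinv hM hδ
    hlift (lt_min (half_pos hε) hη₁)
  obtain ⟨b, -, hb⟩ := exists_ge_dist_iterate_lt hcont hKinv hdense 0 hzK (half_pos hδ)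
  obtain ⟨b', hb', hp'⟩ := exists_ge_dist_iterate_lt hcont hKinv hdense b hp (half_pos hε)
  obtain ⟨a, rfl⟩ := Nat.exists_eq_add_of_le' hb'
  obtain ⟨b'', hb'', hz'⟩ := exists_ge_dist_iterate_lt hcont hKinv hdense (a + b) hzK hη₂
  obtain ⟨c, rfl⟩ := Nat.exists_eq_add_of_le' hb''
  rw [Function.iterate_add_apply] at hz' hp'
  rw [Function.iterate_add_apply] at hz'
  have hxK : f^[b] x₀ ∈ K := iterate_mem_of_image_eq hKinv b hx₀
  generalize f^[b] x₀ = x at *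
  obtain ⟨y, hy, hyz, hyx⟩ := H₂ c (f^[a] x) (iterate_mem_of_image_eq hKinv a hxK) z hzK
    (by rw [dist_comm]; exact hz'.le)
  obtain ⟨w, hw, rfl, hwx⟩ := H₁ a x hxK y hy (hyx.le.trans (min_le_right _ _))
  have hwz : dist w z ≤ δ := by
    have := dist_triangle w x z
    linarith
  refine ⟨f^[a] w, ⟨hy, ⟨c, hyz ▸ horbit 0⟩, exists_preorbit_iterate
    (exists_preorbit_tendsto_infDist hcont hM hlift hzK hfix horbit hw hwz) a⟩, ?_⟩
  have h₁ := hyx.trans_le (min_le_left _ _)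
  have h₂ := dist_triangle (f^[a] w) (f^[a] x) p
  rw [dist_comm]
  linarith
end

section
/- Let d ≥ 1, let f : ℝ^d → ℝ^d be a C^1 map, let K be an expanding set for f, and let p, q ∈ K be two distinct fixed points of f such that their unstable sets within K coincide: {y ∈ K : y has a preorbit contained in K converging to p} = {y ∈ K : y has a preorbit contained in K converging to q}. Then there exists a homoclinic orbit associated to p all of whose points lie in K. -/
open Filter Metric Set

/-- If an expanding set `K` of a `C¹` map of `ℝ^d` contains two
distinct fixed points `p ≠ q` whose unstable sets within `K` coincide, then there
is a homoclinic orbit associated to `p` whose points all lie in `K`. -/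
theorem two_fixed_points_same_unstable_set_homoclinic
    (d : ℕ) (hd : 1 ≤ d)
    (f : EuclideanSpace ℝ (Fin d) → EuclideanSpace ℝ (Fin d))
    (hf : ContDiff ℝ 1 f)
    (K : Set (EuclideanSpace ℝ (Fin d)))
    (hKcomp : IsCompact K) (hKinv : f '' K = K)
    (hKexp : ∃ C > (0 : ℝ), ∃ lam > (1 : ℝ), ∀ y ∈ K,
      ∀ v : EuclideanSpace ℝ (Fin d), ∀ n : ℕ, 1 ≤ n →
        C * lam ^ n * ‖v‖ ≤ ‖fderiv ℝ (f^[n]) y v‖)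
    (hKiso : ∃ U : Set (EuclideanSpace ℝ (Fin d)), IsOpen U ∧ K ⊆ U ∧
      K = ⋂ n : ℕ, f^[n] ⁻¹' U)
    (p q : EuclideanSpace ℝ (Fin d)) (hpK : p ∈ K) (hqK : q ∈ K)
    (hpfix : f p = p) (hqfix : f q = q) (hpq : p ≠ q)
    (hW : {y | y ∈ K ∧ ∃ s : ℕ → EuclideanSpace ℝ (Fin d),
        s 0 = y ∧ (∀ n : ℕ, s n ∈ K) ∧ (∀ n : ℕ, f (s (n + 1)) = s n) ∧
        Tendsto s atTop (nhds p)} =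
      {y | y ∈ K ∧ ∃ s : ℕ → EuclideanSpace ℝ (Fin d),
        s 0 = y ∧ (∀ n : ℕ, s n ∈ K) ∧ (∀ n : ℕ, f (s (n + 1)) = s n) ∧
        Tendsto s atTop (nhds q)}) :
    ∃ x : ℤ → EuclideanSpace ℝ (Fin d),
      (∀ n : ℤ, x n ∈ K) ∧
      (∀ n : ℤ, f (x (n + 1)) = x n) ∧
      Tendsto x atTop (nhds p) ∧ Tendsto x atBot (nhds p) ∧
      ∃ N : ℤ, x N ≠ p := by
  obtain ⟨-, s, hs0, hsK, hsf, hslim⟩ :=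
    hW.subset ⟨hpK, fun _ => p, rfl, fun _ => hpK, fun _ => hpfix, tendsto_const_nhds⟩
  obtain ⟨N, hN⟩ := (hslim.eventually_ne hpq.symm).exists
  -- The tail of `s` shows that `s N` lies in the unstable set of `q`, hence in that of `p`.
  obtain ⟨-, t, ht0, htK, htf, htlim⟩ := hW.superset ⟨hsK N, fun n => s (n + N),
    by simp, fun n => hsK _, fun n => by simpa only [Nat.add_right_comm] using hsf (n + N),
    (tendsto_add_atTop_iff_nat N).2 hslim⟩
  let u : ℕ → EuclideanSpace ℝ (Fin d) := fun n => if n ≤ N then s n else t (n - N)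
  have hu_shift : ∀ n, u (n + N) = t n := by
    intro n
    rcases n.eq_zero_or_pos with rfl | hn
    · simp [u, ht0]
    · simp [u, hn.ne']
  have hu_zero : u 0 = p := by simp [u, hs0]
  have hu_step : ∀ n, f (u (n + 1)) = u n := by
    intro n
    rcases lt_or_ge n N with hn | hn
    · simp [u, hn.le, Nat.succ_le_of_lt hn, hsf]
    · obtain ⟨k, rfl⟩ := Nat.exists_eq_add_of_le' hn
      rw [Nat.add_right_comm, hu_shift, hu_shift, htf]
  have hu_lim : Tendsto u atTop (nhds p) :=
    (tendsto_add_atTop_iff_nat N).1 (by simpa only [hu_shift] using htlim)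
  refine ⟨fun n => u n.toNat, fun n => ?_, fun n => ?_, ?_, ?_, N, by simpa [u] using hN⟩
  · by_cases hn : n.toNat ≤ N
    · simpa only [u, if_pos hn] using hsK _
    · simpa only [u, if_neg hn] using htK _
  · change f (u (n + 1).toNat) = u n.toNat
    rcases le_or_gt 0 n with hn | hn
    · rw [show (n + 1).toNat = n.toNat + 1 by omega, hu_step]
    · rw [show (n + 1).toNat = 0 by omega, show n.toNat = 0 by omega, hu_zero, hpfix]
  · refine hu_lim.comp (tendsto_atTop.2 fun b => ?_)
    filter_upwards [eventually_ge_atTop (b : ℤ)] with n hn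
    omega
  · refine tendsto_const_nhds.congr' ?_
    filter_upwards [eventually_le_atBot (0 : ℤ)] with n hn
    rw [Int.toNat_of_nonpos hn, hu_zero]
end

section
/- Let d ≥ 1, let f : ℝ^d → ℝ^d be a C^1 map and let K be an expanding set for f. Then there exists r > 0 such that for every fixed point p of f with p ∈ K and every y ∈ K with ‖y − p‖ < r, the point y has a preorbit contained in K converging to p; that is, the local ball B_r(p) ∩ K is contained in the unstable set of p within K. -/
open Filter Metric Set

/-- A fixed point at which some power of the derivative is a contraction is asymptotically stable. -/
theorem eventually_iterate_mem_and_tendsto {E : Type*} [NormedAddCommGroup E] [NormedSpace ℝ E]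
    {h : E → E} {B : E →L[ℝ] E} {p : E} (hB : HasFDerivAt h B p) (hp : h p = p)
    {N : ℕ} (hN : 1 ≤ N) (hBN : ‖B ^ N‖ ≤ 1 / 4) {V : Set E} (hV : V ∈ nhds p) :
    ∀ᶠ y in nhds p, (∀ n, h^[n] y ∈ V) ∧ Tendsto (fun n => h^[n] y) atTop (nhds p) := by
  have hfix : ∀ n, h^[n] p = p := fun n => Function.iterate_fixed hp n
  have hcont : ∀ n, Tendsto h^[n] (nhds p) (nhds p) := fun n => by
    simpa [ContinuousAt, hfix n] using hB.continuousAt.iterate hp n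
  have hcontr : ∀ᶠ y in nhds p, ‖h^[N] y - p‖ ≤ 1 / 2 * ‖y - p‖ := by
    have hder := (hB.iterate hp N).isLittleO.def (show (0 : ℝ) < 1 / 4 by norm_num)
    filter_upwards [hder] with y hy
    rw [hfix N] at hy
    have h1 := (B ^ N).le_of_opNorm_le hBN (y - p)
    have h2 := norm_add_le (h^[N] y - p - (B ^ N) (y - p)) ((B ^ N) (y - p))
    rw [sub_add_cancel] at h2
    linarith
  have hmem : ∀ W ∈ nhds p, ∀ᶠ y in nhds p, ∀ j < N, h^[j] y ∈ W := fun W hW =>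
    (eventually_all_finite (finite_lt_nat N)).2 fun j _ => hcont j hW
  obtain ⟨ρ, hρ, hball⟩ := Metric.eventually_nhds_iff_ball.1 (hcontr.and (hmem V hV))
  have hsplit : ∀ n y, h^[n] y = h^[n % N] ((h^[N])^[n / N] y) := fun n y => by
    rw [← Function.iterate_mul, ← Function.iterate_add_apply, Nat.mod_add_div]
  filter_upwards [ball_mem_nhds p hρ] with y hy
  have hdecay : ∀ k, (h^[N])^[k] y ∈ ball p ρ ∧ ‖(h^[N])^[k] y - p‖ ≤ (1 / 2) ^ k * ‖y - p‖ := by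
    intro k
    induction k with
    | zero => simpa using hy
    | succ k ih =>
      have h1 := (hball _ ih.1).1
      rw [Function.iterate_succ_apply']
      have h2 := ih.1
      rw [mem_ball_iff_norm] at h2 ⊢
      refine ⟨by linarith [norm_nonneg ((h^[N])^[k] y - p)], h1.trans ?_⟩
      rw [pow_succ]
      linarith [ih.2]
  have hlim : Tendsto (fun k => (h^[N])^[k] y) atTop (nhds p) := by
    rw [tendsto_iff_norm_sub_tendsto_zero]
    refine squeeze_zero (fun _ => norm_nonneg _) (fun k => (hdecay k).2) ?_
    simpa using (tendsto_pow_atTop_nhds_zero_of_lt_one (r := (1 / 2 : ℝ))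
      (by norm_num) (by norm_num)).mul_const ‖y - p‖
  refine ⟨fun n => ?_, fun W hW => ?_⟩
  · rw [hsplit]
    exact (hball _ (hdecay _).1).2 _ (Nat.mod_lt _ hN)
  · have := (hlim.comp (Nat.tendsto_div_const_atTop (by omega : N ≠ 0))).eventually (hmem W hW)
    refine mem_map.2 ?_
    filter_upwards [this] with n hn
    rw [mem_preimage, hsplit]
    exact hn _ (Nat.mod_lt _ hN)

/-- An endomorphism of a finite-dimensional space whose iterates expand exponentially is
invertible, and some power of its inverse is a contraction. -/
theorem exists_equiv_norm_symm_pow_le {E : Type*} [NormedAddCommGroup E] [NormedSpace ℝ E]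
    [FiniteDimensional ℝ E] (A : E →L[ℝ] E) {C lam : ℝ} (hC : 0 < C) (hlam : 1 < lam)
    (hA : ∀ v, ∀ n : ℕ, 1 ≤ n → C * lam ^ n * ‖v‖ ≤ ‖(A ^ n) v‖) :
    ∃ e : E ≃L[ℝ] E, (e : E →L[ℝ] E) = A ∧
      ∃ N : ℕ, 1 ≤ N ∧ ‖(e.symm : E →L[ℝ] E) ^ N‖ ≤ 1 / 4 := by
  have hinj : Function.Injective (A : E →ₗ[ℝ] E) := by
    rw [injective_iff_map_eq_zero]
    intro v hv
    have h1 := hA v 1 le_rfl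
    have hv' : A v = 0 := hv
    rw [pow_one, pow_one, hv', norm_zero] at h1
    have : 0 < C * lam := by positivity
    exact norm_le_zero_iff.1 (by nlinarith)
  let e : E ≃L[ℝ] E := (LinearEquiv.ofInjectiveEndo (A : E →ₗ[ℝ] E) hinj).toContinuousLinearEquiv
  have he : (e : E →L[ℝ] E) = A := by
    ext v
    rfl
  refine ⟨e, he, ?_⟩
  obtain ⟨N, hN⟩ := ((tendsto_pow_atTop_atTop_of_one_lt hlam).eventually_ge_atTop (4 / C)).and
    (eventually_ge_atTop 1) |>.exists
  refine ⟨N, hN.2, ContinuousLinearMap.opNorm_le_bound _ (by norm_num) fun v => ?_⟩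
  have hinv : (A ^ N) (((e.symm : E →L[ℝ] E) ^ N) v) = v := by
    rw [FunLike.coe_pow_eq_iterate, FunLike.coe_pow_eq_iterate, ← he]
    exact (Function.LeftInverse.iterate e.apply_symm_apply N) v
  have h1 := hA (((e.symm : E →L[ℝ] E) ^ N) v) N hN.2
  rw [hinv] at h1
  have h2 : 4 ≤ C * lam ^ N := by
    have := (div_le_iff₀ hC).1 hN.1
    linarith
  nlinarith [norm_nonneg (((e.symm : E →L[ℝ] E) ^ N) v)]

/-- Around an expanding fixed point `p` there is a local inverse branch all of whose orbits stay
in a prescribed neighbourhood and converge to `p`; in particular `p` is an isolated fixed point. -/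
theorem exists_attracting_inverse_branch {E : Type*} [NormedAddCommGroup E] [NormedSpace ℝ E]
    [FiniteDimensional ℝ E] {f : E → E} (hf : ContDiff ℝ 1 f) {p : E} (hp : f p = p)
    {C lam : ℝ} (hC : 0 < C) (hlam : 1 < lam)
    (hexp : ∀ v, ∀ n : ℕ, 1 ≤ n → C * lam ^ n * ‖v‖ ≤ ‖fderiv ℝ (f^[n]) p v‖)
    {U : Set E} (hU : U ∈ nhds p) :
    (∀ᶠ q in nhds p, f q = q → q = p) ∧
      ∀ᶠ y in nhds p, ∃ s : ℕ → E, s 0 = y ∧ (∀ n, s n ∈ U) ∧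
        (∀ n, f (s (n + 1)) = s n) ∧ Tendsto s atTop (nhds p) := by
  have : CompleteSpace E := FiniteDimensional.complete ℝ E
  have hstrict : HasStrictFDerivAt f (fderiv ℝ f p) p :=
    hf.contDiffAt.hasStrictFDerivAt one_ne_zero
  obtain ⟨e, he, N, hN, hBN⟩ := exists_equiv_norm_symm_pow_le (fderiv ℝ f p) hC hlam
    fun v n hn => by
      simpa [(hstrict.hasFDerivAt.iterate hp n).fderiv] using hexp v n hn
  rw [← he] at hstrict
  let h := hstrict.localInverse f e p
  have hder : HasFDerivAt h (e.symm : E →L[ℝ] E) p := by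
    have := hstrict.to_localInverse.hasFDerivAt
    rwa [hp] at this
  have hhp : h p = p := by
    have := hstrict.localInverse_apply_image
    rwa [hp] at this
  have hright : ∀ᶠ y in nhds p, f (h y) = y := by
    have := hstrict.eventually_right_inverse
    rwa [hp] at this
  have hstable := eventually_iterate_mem_and_tendsto hder hhp hN hBN (inter_mem hU hright)
  constructor
  · filter_upwards [hstable, hstrict.eventually_left_inverse] with q hq hleft hfix
    have hhq : h q = q := by rwa [hfix] at hleft
    have hlim := hq.2
    simp only [Function.iterate_fixed hhq] at hlim
    exact tendsto_nhds_unique tendsto_const_nhds hlim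
  · filter_upwards [hstable] with y hy
    refine ⟨fun n => h^[n] y, rfl, fun n => (hy.1 n).1, fun n => ?_, hy.2⟩
    simp only [Function.iterate_succ_apply']
    exact (hy.1 n).2

/-- A preorbit inside an isolating neighbourhood of a maximal invariant set `K`, starting in `K`,
stays in `K`. -/
theorem preorbit_mem_of_isolated {X : Type*} {f : X → X} {K U : Set X}
    (hKU : K = ⋂ n : ℕ, f^[n] ⁻¹' U) {s : ℕ → X} (h0 : s 0 ∈ K) (hsU : ∀ n, s n ∈ U)
    (hs : ∀ n, f (s (n + 1)) = s n) (n : ℕ) : s n ∈ K := by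
  induction n with
  | zero => exact h0
  | succ n ih =>
    rw [hKU, mem_iInter] at ih ⊢
    rintro (_ | m)
    · exact hsU _
    · rw [mem_preimage, Function.iterate_succ_apply, hs]
      exact ih m



/-- On an expanding set `K` of a `C¹` map of `ℝ^d` there is a
uniform `r > 0` such that for every fixed point `p ∈ K`, every point of `K` at
distance less than `r` from `p` has a preorbit in `K` converging to `p`;
i.e. `B_r(p) ∩ K` is contained in the unstable set of `p` within `K`. -/
theorem expanding_set_local_unstable_ball
    (d : ℕ) (hd : 1 ≤ d)
    (f : EuclideanSpace ℝ (Fin d) → EuclideanSpace ℝ (Fin d))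
    (hf : ContDiff ℝ 1 f)
    (K : Set (EuclideanSpace ℝ (Fin d)))
    (hKcomp : IsCompact K) (hKinv : f '' K = K)
    (hKexp : ∃ C > (0 : ℝ), ∃ lam > (1 : ℝ), ∀ y ∈ K,
      ∀ v : EuclideanSpace ℝ (Fin d), ∀ n : ℕ, 1 ≤ n →
        C * lam ^ n * ‖v‖ ≤ ‖fderiv ℝ (f^[n]) y v‖)
    (hKiso : ∃ U : Set (EuclideanSpace ℝ (Fin d)), IsOpen U ∧ K ⊆ U ∧
      K = ⋂ n : ℕ, f^[n] ⁻¹' U) :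
    ∃ r > (0 : ℝ), ∀ p ∈ K, f p = p → ∀ y ∈ K, ‖y - p‖ < r →
      ∃ s : ℕ → EuclideanSpace ℝ (Fin d), s 0 = y ∧
        (∀ n : ℕ, s n ∈ K) ∧ (∀ n : ℕ, f (s (n + 1)) = s n) ∧
        Tendsto s atTop (nhds p) := by
  obtain ⟨C, hC, lam, hlam, hexp⟩ := hKexp
  obtain ⟨U, hUo, hKsub, hKU⟩ := hKiso
  refine hKcomp.induction_on (p := fun t => ∃ r > (0 : ℝ), ∀ p ∈ t, f p = p → ∀ y ∈ K,
    ‖y - p‖ < r → ∃ s : ℕ → EuclideanSpace ℝ (Fin d), s 0 = y ∧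
        (∀ n : ℕ, s n ∈ K) ∧ (∀ n : ℕ, f (s (n + 1)) = s n) ∧
        Tendsto s atTop (nhds p)) ⟨1, one_pos, by simp⟩ ?_ ?_ ?_
  · rintro t t' htt' ⟨r, hr, h⟩
    exact ⟨r, hr, fun p hp => h p (htt' hp)⟩
  · rintro t t' ⟨r, hr, h⟩ ⟨r', hr', h'⟩
    refine ⟨min r r', lt_min hr hr', ?_⟩
    rintro p (hp | hp) hfp y hy hyp
    · exact h p hp hfp y hy (hyp.trans_le (min_le_left _ _))
    · exact h' p hp hfp y hy (hyp.trans_le (min_le_right _ _))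
  · intro x hx
    by_cases hfx : f x = x
    · obtain ⟨hiso, hbranch⟩ := exists_attracting_inverse_branch hf hfx hC hlam (hexp x hx)
        (hUo.mem_nhds (hKsub hx))
      obtain ⟨r, hr, hball⟩ := Metric.eventually_nhds_iff_ball.1 hbranch
      refine ⟨_, mem_nhdsWithin_of_mem_nhds hiso, r, hr, ?_⟩
      intro q hq hfq y hy hyq
      obtain rfl := hq hfq
      obtain ⟨s, hs0, hsU, hs, hlim⟩ := hball y (mem_ball_iff_norm.2 hyq)
      exact ⟨s, hs0, preorbit_mem_of_isolated hKU (hs0 ▸ hy) hsU hs, hs, hlim⟩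
    · refine ⟨{q | f q ≠ q}, mem_nhdsWithin_of_mem_nhds
        ((isOpen_ne_fun hf.continuous continuous_id).mem_nhds hfx), 1, one_pos, ?_⟩
      exact fun q hq hfq => absurd hfq hq
end

section
/- Let f : ℝ → ℝ be a C^1 map and let p be a repellor fixed point of f (f(p) = p and |f'(p)| > 1). Suppose that f has no homoclinic orbit associated to p, i.e. there is no q ∈ W^u(p) with q ≠ p and f^n(q) = p for some n ≥ 1. Then p has no preimage in the closure of W^u(p) other than p itself: f^{−1}({p}) ∩ clos(W^u(p)) = {p}. In particular no point of the boundary ∂W^u(p) is mapped to p by f. -/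
open Filter Set

/-- Let `W` be an order-connected set mapped onto itself by `g`, on which `p` is the only
preimage of the fixed point `p`. If `g` sends some point of `W` below `p` to a point below `p`, then no
point of `closure W` above `p` is mapped to `p`. -/
lemma le_of_mem_closure_of_map_eq {α : Type*} [ConditionallyCompleteLinearOrder α]
    [TopologicalSpace α] [OrderTopology α] [DenselyOrdered α] {g : α → α} {W : Set α} {p x : α}
    (hg : Continuous g) (hW : W.OrdConnected) (hgW : g '' W = W) (hp : p ∈ W) (hgp : g p = p)
    (huniq : ∀ y ∈ W, g y = p → y = p) (hlow : ∃ y ∈ W, y < p ∧ g y < p)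
    (hx : x ∈ closure W) (hgx : g x = p) : x ≤ p := by
  by_contra! hpx
  have hxW : x ∉ W := fun h => hpx.ne' (huniq x h hgx)
  have hlt : ∀ w ∈ W, w < x := fun w hw => by
    by_contra! h
    exact hxW (hW.out hp hw ⟨hpx.le, h⟩)
  have hex : ∀ y < x, ∃ w ∈ W, y < w := fun y hy => by
    obtain ⟨w, hyw, hw⟩ := mem_closure_iff.1 hx _ isOpen_Ioi hy
    exact ⟨w, hw, hyw⟩
  have hbelow : ∀ y ∈ W, y < p → g y ≤ p := fun y hy hyp => by
    by_contra! h
    obtain ⟨y₀, hy₀, hy₀p, hgy₀⟩ := hlow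
    obtain ⟨z, hz, hgz⟩ := intermediate_value_uIcc (a := y₀) (b := y) hg.continuousOn
      (mem_uIcc.2 (Or.inl ⟨hgy₀.le, h.le⟩))
    have hzp : z < p := hz.2.trans_lt (max_lt hy₀p hyp)
    exact hzp.ne (huniq z (hW.uIcc_subset hy₀ hy hz) hgz)
  obtain ⟨c, hc, hmax⟩ := isCompact_Icc.exists_isMaxOn (nonempty_Icc.2 hpx.le) hg.continuousOn
  have hgc : g c < x := by
    rcases hc.2.eq_or_lt with rfl | hcx
    · rwa [hgx]
    · obtain ⟨w, hw, hcw⟩ := hex c hcx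
      exact hlt _ (hgW ▸ mem_image_of_mem g (hW.out hp hw ⟨hc.1, hcw.le⟩))
  have hpgc : p ≤ g c := hgp ▸ hmax (left_mem_Icc.2 hpx.le)
  obtain ⟨w, hw, hcw⟩ := hex _ hgc
  obtain ⟨v, hv, rfl⟩ : w ∈ g '' W := hgW.symm ▸ hw
  rcases lt_or_ge v p with hvp | hvp
  · exact (hcw.trans_le (hbelow v hv hvp)).not_ge hpgc
  · exact hcw.not_ge (hmax ⟨hvp, (hlt v hv).le⟩)

/-- The set of points having a preorbit under `f` that converges to `p`. -/
def unstableSet {α : Type*} [TopologicalSpace α] (f : α → α) (p : α) : Set α :=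
  {y | ∃ s : ℕ → α, s 0 = y ∧ (∀ n : ℕ, f (s (n + 1)) = s n) ∧ Tendsto s atTop (nhds p)}

section unstableSet

variable {α : Type*} [TopologicalSpace α] {f : α → α} {p : α}

lemma mem_unstableSet_self (hfix : f p = p) : p ∈ unstableSet f p :=
  ⟨fun _ => p, rfl, fun _ => hfix, tendsto_const_nhds⟩

lemma image_unstableSet : f '' unstableSet f p = unstableSet f p := by
  apply Subset.antisymm
  · rintro _ ⟨y, ⟨s, rfl, hs, hlim⟩, rfl⟩
    refine ⟨fun n => Nat.casesOn n (f (s 0)) s, rfl, fun n => ?_, ?_⟩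
    · cases n with
      | zero => rfl
      | succ n => exact hs n
    · exact (tendsto_add_atTop_iff_nat 1).1 hlim
  · rintro _ ⟨s, rfl, hs, hlim⟩
    exact ⟨s 1, ⟨fun n => s (n + 1), rfl, fun n => hs (n + 1),
      (tendsto_add_atTop_iff_nat 1).2 hlim⟩, hs 0⟩

lemma iterate_image_unstableSet (n : ℕ) : f^[n] '' unstableSet f p = unstableSet f p := by
  induction n with
  | zero => simp
  | succ n ih => rw [Function.iterate_succ, image_comp, image_unstableSet, ih]

lemma unstableSet_eq_iUnion {U : Set α} (hU : U ∈ nhds p) (hUW : U ⊆ unstableSet f p) :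
    unstableSet f p = ⋃ n : ℕ, f^[n] '' U := by
  apply Subset.antisymm
  · rintro _ ⟨s, rfl, hs, hlim⟩
    obtain ⟨n, hn⟩ := (hlim.eventually_mem hU).exists
    have hiter : ∀ n : ℕ, f^[n] (s n) = s 0 := fun n => by
      induction n with
      | zero => rfl
      | succ n ih => rw [Function.iterate_succ_apply, hs, ih]
    exact mem_iUnion.2 ⟨n, s n, hn, hiter n⟩
  · exact iUnion_subset fun n => (image_mono hUW).trans (iterate_image_unstableSet n).subset

lemma isPreconnected_unstableSet (hf : Continuous f) (hfix : f p = p) {U : Set α}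
    (hU : U ∈ nhds p) (hconn : IsPreconnected U) (hUW : U ⊆ unstableSet f p) :
    IsPreconnected (unstableSet f p) := by
  rw [unstableSet_eq_iUnion hU hUW]
  exact isPreconnected_iUnion
    ⟨p, mem_iInter.2 fun n => ⟨p, mem_of_mem_nhds hU, Function.iterate_fixed hfix n⟩⟩
    fun n => hconn.image _ (hf.iterate n).continuousOn

end unstableSet

/-- A repellor of a map of the line has a ball around it contained in its unstable set. -/
lemma exists_ball_subset_unstableSet {f : ℝ → ℝ} {p d : ℝ} (hd : HasStrictDerivAt f d p)
    (hfix : f p = p) (hrep : 1 < |d|) : ∃ ε > 0, Metric.ball p ε ⊆ unstableSet f p := by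
  obtain ⟨c, hc1, hcd⟩ := exists_between hrep
  have hc0 : 0 < c := one_pos.trans hc1
  have hexp : ∀ᶠ z in nhds p, c * |z - p| ≤ |f z - p| := by
    filter_upwards [hd.hasDerivAt.isLittleO.def (sub_pos.2 hcd)] with z hz
    simp only [hfix, smul_eq_mul, Real.norm_eq_abs] at hz
    have h := abs_sub_abs_le_abs_sub ((z - p) * d) (f z - p)
    rw [abs_sub_comm ((z - p) * d), abs_mul] at h
    linarith
  obtain ⟨δ, hδ, hball⟩ := Metric.eventually_nhds_iff_ball.1 hexp
  have himage : f '' Metric.ball p δ ∈ nhds p := by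
    have h := image_mem_map (m := f) (Metric.ball_mem_nhds p hδ)
    rwa [hd.map_nhds_eq (abs_pos.1 (one_pos.trans hrep)), hfix] at h
  obtain ⟨ε, hε, hεsub⟩ := Metric.mem_nhds_iff.1 himage
  have hpre : ∀ y : Metric.ball p ε, ∃ z : Metric.ball p ε,
      f z = y ∧ |(z : ℝ) - p| ≤ c⁻¹ * |(y : ℝ) - p| := by
    rintro ⟨y, hy⟩
    obtain ⟨z, hz, rfl⟩ := hεsub hy
    have hle := hball z hz
    have hzε : z ∈ Metric.ball p ε := by
      rw [Metric.mem_ball, Real.dist_eq] at hy ⊢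
      nlinarith [abs_nonneg (z - p)]
    refine ⟨⟨z, hzε⟩, rfl, ?_⟩
    rwa [inv_mul_eq_div, le_div_iff₀' hc0]
  choose φ hφ hφc using hpre
  refine ⟨ε, hε, fun y hy => ?_⟩
  have hbound : ∀ n : ℕ, |((φ^[n] ⟨y, hy⟩ : Metric.ball p ε) : ℝ) - p| ≤ c⁻¹ ^ n * |y - p| := by
    intro n
    induction n with
    | zero => simp
    | succ n ih =>
      rw [Function.iterate_succ_apply', pow_succ', mul_assoc]
      exact (hφc _).trans (mul_le_mul_of_nonneg_left ih (inv_pos.2 hc0).le)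
  refine ⟨fun n => φ^[n] ⟨y, hy⟩, rfl, fun n => ?_, ?_⟩
  · beta_reduce
    rw [Function.iterate_succ_apply', hφ]
  · rw [tendsto_iff_dist_tendsto_zero]
    refine squeeze_zero (fun _ => dist_nonneg) hbound ?_
    simpa using (tendsto_pow_atTop_nhds_zero_of_lt_one (inv_pos.2 hc0).le
      (inv_lt_one_of_one_lt₀ hc1)).mul_const |y - p|

/-- Let `p` be a repellor fixed point of a `C¹` map `f : ℝ → ℝ`.
If `f` has no homoclinic orbit associated to `p`, then `p` has no preimage in the
closure of its unstable set other than `p` itself; in particular no point of the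
boundary of `W^u(p)` is mapped to `p`. -/
theorem no_homoclinic_no_preimage_in_closure_unstable
    (f : ℝ → ℝ) (hf : ContDiff ℝ 1 f)
    (p : ℝ) (hfix : f p = p) (hrep : 1 < |deriv f p|)
    (W : Set ℝ)
    (hW : W = {y | ∃ s : ℕ → ℝ, s 0 = y ∧ (∀ n : ℕ, f (s (n + 1)) = s n) ∧
      Tendsto s atTop (nhds p)})
    (hnoh : ¬ ∃ q ∈ W, q ≠ p ∧ ∃ n : ℕ, 1 ≤ n ∧ f^[n] q = p) :
    f ⁻¹' {p} ∩ closure W = {p} ∧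
    ∀ x ∈ frontier W, f x = p → x = p := by
  obtain rfl : W = unstableSet f p := hW
  have hd : HasStrictDerivAt f (deriv f p) p := hf.contDiffAt.hasStrictDerivAt one_ne_zero
  have hpW : p ∈ unstableSet f p := mem_unstableSet_self hfix
  obtain ⟨ε, hε, hball⟩ := exists_ball_subset_unstableSet hd hfix hrep
  have hU := Metric.ball_mem_nhds p hε
  have hconn : (unstableSet f p).OrdConnected := (isPreconnected_unstableSet hf.continuous hfix hU
    (convex_ball p ε).isPreconnected hball).ordConnected
  have huniq : ∀ y ∈ unstableSet f p, f^[2] y = p → y = p := fun y hy h => by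
    by_contra hne
    exact hnoh ⟨y, hy, hne, 2, one_le_two, h⟩
  -- The second iterate has positive derivative at `p`, hence preserves both sides of `p`.
  have hslope : ∀ᶠ y in nhdsWithin p {p}ᶜ, y ∈ unstableSet f p ∧ 0 < slope f^[2] p y := by
    have hd2 : HasDerivAt f^[2] (deriv f p ^ 2) p := hd.hasDerivAt.iterate _ hfix 2
    have hpos : 0 < deriv f p ^ 2 := by
      have := abs_pos.1 (one_pos.trans hrep)
      positivity
    filter_upwards [hd2.tendsto_slope.eventually_const_lt hpos, nhdsWithin_le_nhds hU]
      with y hy hyU using ⟨hball hyU, hy⟩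
  have hg : Continuous f^[2] := hf.continuous.iterate 2
  have hgp : f^[2] p = p := Function.iterate_fixed hfix 2
  have hlow : ∃ y ∈ unstableSet f p, y < p ∧ f^[2] y < p := by
    obtain ⟨y, ⟨hyW, hy⟩, hyp⟩ := ((hslope.filter_mono
      (nhdsWithin_mono p fun y (hy : y ∈ Iio p) => hy.ne)).and self_mem_nhdsWithin).exists
    refine ⟨y, hyW, hyp, ?_⟩
    rw [slope_def_field, hgp] at hy
    exact sub_neg.1 ((div_pos_iff.1 hy).resolve_left fun h => (sub_neg.2 hyp).not_gt h.2).1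
  have hhigh : ∃ y ∈ unstableSet f p, p < y ∧ p < f^[2] y := by
    obtain ⟨y, ⟨hyW, hy⟩, hyp⟩ := ((hslope.filter_mono
      (nhdsWithin_mono p fun y (hy : y ∈ Ioi p) => hy.ne')).and self_mem_nhdsWithin).exists
    refine ⟨y, hyW, hyp, ?_⟩
    rw [slope_def_field, hgp] at hy
    exact sub_pos.1 ((div_pos_iff_of_pos_right (sub_pos.2 hyp)).1 hy)
  have hmain : ∀ x ∈ closure (unstableSet f p), f x = p → x = p := fun x hx hfx => by
    have hgx : f^[2] x = p := by rw [Function.iterate_succ_apply, hfx]; exact hfix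
    refine le_antisymm (le_of_mem_closure_of_map_eq hg hconn (iterate_image_unstableSet 2)
      hpW hgp huniq hlow hx hgx) ?_
    exact le_of_mem_closure_of_map_eq (α := ℝᵒᵈ) hg hconn.dual (iterate_image_unstableSet 2)
      hpW hgp huniq hhigh hx hgx
  refine ⟨Subset.antisymm (fun x hx => hmain x hx.2 hx.1) ?_, fun x hx => hmain x hx.1⟩
  rintro _ rfl
  exact ⟨hfix, subset_closure hpW⟩
end
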